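/- Let r > 0, θ ∈ ℝ, σ > 0, and let h : ℝ → ℝ be bounded and measurable. Let f_h be the solution of the VG(r,θ,σ,0) Stein equation with test function h. Then for every x ≠ 0 and every d ∈ ℝ such that f_h has derivative d at x, |x·d| ≤ (2√(θ²+σ²)/σ²)·(1 + 6/r + B(r,θ,σ)) · sup_{t∈ℝ} |h̃(t)|. -/

import Mathlib

open MeasureTheory Real Filter

/-- Modified Bessel function of the second kind. -/
noncomputable def besselK (ν x : ℝ) : ℝ :=
  ∫ t in Set.Ioi (0:ℝ), Real.exp (-x * Real.cosh t) * Real.cosh (ν * t)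

/-- Modified Bessel function of the first kind. -/
noncomputable def besselI (ν x : ℝ) : ℝ :=
  ∑' k : ℕ, (x / 2) ^ (ν + 2 * (k : ℝ)) / (Real.Gamma (ν + (k : ℝ) + 1) * (Nat.factorial k))

/-- The VG(r,θ,σ,0) density. -/
noncomputable def vgDensity (r θ σ x : ℝ) : ℝ :=
  (σ * Real.sqrt Real.pi * Real.Gamma (r / 2))⁻¹ * Real.exp (θ * x / σ ^ 2) *
    (|x| / (2 * Real.sqrt (θ ^ 2 + σ ^ 2))) ^ ((r - 1) / 2) *
    besselK ((r - 1) / 2) (Real.sqrt (θ ^ 2 + σ ^ 2) * |x| / σ ^ 2)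

/-- The centred test function h̃(x) = h(x) − E h(Z). -/
noncomputable def htilde (r θ σ : ℝ) (h : ℝ → ℝ) (x : ℝ) : ℝ :=
  h x - ∫ t, h t * vgDensity r θ σ t

/-- The solution of the VG(r,θ,σ,0) Stein equation with test function h. -/
noncomputable def steinSolution (r θ σ : ℝ) (h : ℝ → ℝ) (x : ℝ) : ℝ :=
  -(Real.exp (-(θ / σ ^ 2) * x) *
      besselK ((r - 1) / 2) (Real.sqrt (θ ^ 2 + σ ^ 2) / σ ^ 2 * |x|) /
      (σ ^ 2 * |x| ^ ((r - 1) / 2))) *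
    (∫ t in (0:ℝ)..x, Real.exp ((θ / σ ^ 2) * t) * |t| ^ ((r - 1) / 2) *
      besselI ((r - 1) / 2) (Real.sqrt (θ ^ 2 + σ ^ 2) / σ ^ 2 * |t|) * htilde r θ σ h t) -
  (Real.exp (-(θ / σ ^ 2) * x) *
      besselI ((r - 1) / 2) (Real.sqrt (θ ^ 2 + σ ^ 2) / σ ^ 2 * |x|) /
      (σ ^ 2 * |x| ^ ((r - 1) / 2))) *
    (∫ t in Set.Ioi x, Real.exp ((θ / σ ^ 2) * t) * |t| ^ ((r - 1) / 2) *
      besselK ((r - 1) / 2) (Real.sqrt (θ ^ 2 + σ ^ 2) / σ ^ 2 * |t|) * htilde r θ σ h t)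

/-- The constant A(r,θ,σ). -/
noncomputable def Aconst (r θ σ : ℝ) : ℝ :=
  if 2 ≤ r then 2 * Real.sqrt Real.pi / Real.sqrt (2 * r - 1) * (1 + θ ^ 2 / σ ^ 2) ^ (r / 2)
  else 12 * Real.Gamma (r / 2) * (1 + θ ^ 2 / σ ^ 2)

/-- The constant B(r,θ,σ). -/
noncomputable def Bconst (r θ σ : ℝ) : ℝ :=
  if 2 ≤ r then Real.sqrt (Real.pi * (r - 1) / 2) * (1 + θ ^ 2 / σ ^ 2) ^ (r / 2 - 1)
  else 2

/-- The constant C(r,θ,σ). -/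
noncomputable def Cconst (r θ σ : ℝ) : ℝ :=
  6 + 2 * Real.sqrt 2 / Real.sqrt r +
    2 * Real.sqrt (2 * Real.pi * (r + 1)) * (|θ| / σ) * (1 + θ ^ 2 / σ ^ 2) ^ ((r - 1) / 2) +
    2 * (Real.sqrt (2 * r) + r) * Aconst r θ σ

/-! ### Power series part -/

noncomputable def PP (ν z : ℝ) : ℝ := ∑' k : ℕ, z ^ k / (Real.Gamma (ν + (k : ℝ) + 1) * (Nat.factorial k))

lemma gamma_lower {ν : ℝ} (hν : -1 < ν) : ∃ m : ℝ, 0 < m ∧ ∀ k : ℕ, m ≤ Real.Gamma (ν + k + 1) := by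
  have h1 : 0 < Real.Gamma (ν + 1) := Real.Gamma_pos_of_pos (by linarith)
  have h2 : 0 < Real.Gamma (ν + 2) := Real.Gamma_pos_of_pos (by linarith)
  refine ⟨min (Real.Gamma (ν+1)) (Real.Gamma (ν+2)), lt_min h1 h2, ?_⟩
  have key : ∀ k : ℕ, Real.Gamma (ν + 2) ≤ Real.Gamma (ν + (k + 1 : ℕ) + 1) := by
    intro k
    induction k with
    | zero => apply le_of_eq; congr 1; push_cast; ring
    | succ n ih =>
      have hp : 0 < ν + (n + 1 : ℕ) + 1 := by push_cast; have : (0:ℝ) ≤ n := n.cast_nonneg; linarith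
      have := Real.Gamma_add_one hp.ne'
      have e : ν + ((n + 1 + 1 : ℕ) : ℝ) + 1 = ν + (n + 1 : ℕ) + 1 + 1 := by push_cast; ring
      rw [e, this]
      have hg := Real.Gamma_pos_of_pos hp
      have h1 : (1:ℝ) ≤ ν + (n + 1 : ℕ) + 1 := by push_cast; have : (0:ℝ) ≤ n := n.cast_nonneg; linarith
      nlinarith
  intro k
  cases k with
  | zero => simp
  | succ n => exact (min_le_right _ _).trans (key n)

lemma PP_term_bound {ν : ℝ} {m : ℝ} (hm : 0 < m) (hk : ∀ k : ℕ, m ≤ Real.Gamma (ν + k + 1))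
    (z R : ℝ) (hz : |z| ≤ R) (k : ℕ) :
    ‖z ^ k / (Real.Gamma (ν + (k : ℝ) + 1) * (Nat.factorial k))‖ ≤ m⁻¹ * (R ^ k / (Nat.factorial k)) := by
  have hf : (0:ℝ) < Nat.factorial k := by positivity
  have hG := hm.trans_le (hk k)
  rw [Real.norm_eq_abs, abs_div, abs_pow, abs_of_pos (mul_pos hG hf)]
  have : m⁻¹ * (R ^ k / (Nat.factorial k)) = R ^ k / (m * Nat.factorial k) := by field_simp
  rw [this]
  have := hk k
  gcongr
  exact pow_nonneg ((abs_nonneg z).trans hz) k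

lemma PP_summable {ν : ℝ} (hν : -1 < ν) (z : ℝ) :
    Summable (fun k : ℕ => z ^ k / (Real.Gamma (ν + (k : ℝ) + 1) * (Nat.factorial k))) := by
  obtain ⟨m, hm, hk⟩ := gamma_lower hν
  refine Summable.of_norm_bounded ((Real.summable_pow_div_factorial |z|).mul_left m⁻¹) ?_
  intro k
  exact PP_term_bound hm hk z |z| le_rfl k

lemma PP_hasDerivAt {ν : ℝ} (hν : -1 < ν) (z : ℝ) : HasDerivAt (PP ν) (PP (ν + 1) z) z := by
  obtain ⟨m, hm, hk⟩ := gamma_lower hν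
  set R := |z| + 1 with hR
  have hRpos : 0 < R := by positivity
  let g : ℕ → ℝ → ℝ := fun k z => z ^ k / (Real.Gamma (ν + (k : ℝ) + 1) * (Nat.factorial k))
  let g' : ℕ → ℝ → ℝ := fun k z => (k * z ^ (k-1)) / (Real.Gamma (ν + (k : ℝ) + 1) * (Nat.factorial k))
  let u : ℕ → ℝ := fun k => m⁻¹ * ((k * R ^ (k-1)) / (Nat.factorial k))
  have hg'succ : ∀ k : ℕ, ∀ z, g' (k+1) z = z ^ k / (Real.Gamma (ν + 1 + (k : ℝ) + 1) * (Nat.factorial k)) := by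
    intro k z
    simp only [g', Nat.factorial_succ, Nat.add_sub_cancel]
    have e : ν + ((k + 1 : ℕ) : ℝ) + 1 = ν + 1 + k + 1 := by push_cast; ring
    rw [e]
    have : ((k + 1 : ℕ) : ℝ) ≠ 0 := by positivity
    push_cast at this ⊢
    have hp : 0 < ν + 1 + (k:ℝ) + 1 := by have : (0:ℝ) ≤ k := k.cast_nonneg; linarith
    have := (Real.Gamma_pos_of_pos hp).ne'
    field_simp
  have hu : Summable u := by
    apply Summable.mul_left
    rw [← summable_nat_add_iff 1]
    refine (Real.summable_pow_div_factorial R).congr ?_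
    intro k
    rw [Nat.factorial_succ]
    have : ((k + 1 : ℕ) : ℝ) ≠ 0 := by positivity
    push_cast at this ⊢
    field_simp
  have H := hasDerivAt_tsum_of_isPreconnected (g := g) (g' := g') (u := u) (t := Metric.ball 0 R) (y₀ := 0) (y := z)
    hu Metric.isOpen_ball (convex_ball 0 R).isPreconnected ?_ ?_ (by simp [hRpos]) (PP_summable hν 0) (by simp [hR])
  · have e : ∑' n, g' n z = PP (ν + 1) z := by
      have hs : Summable (fun n => g' n z) := by
        rw [← summable_nat_add_iff 1]
        refine (PP_summable (ν := ν + 1) (by linarith) z).congr ?_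
        intro k; exact (hg'succ k z).symm
      rw [hs.tsum_eq_zero_add]
      simp only [hg'succ]
      simp [g', PP]
    rw [e] at H
    exact H
  · intro n y _
    exact (hasDerivAt_pow n y).div_const _
  · intro n y hy
    have hy' : |y| ≤ R := by
      have := Metric.mem_ball.1 hy
      rw [Real.dist_eq, sub_zero] at this
      exact this.le
    have hf : (0:ℝ) < Nat.factorial n := by positivity
    have hG := hm.trans_le (hk n)
    simp only [g', u]
    rw [Real.norm_eq_abs, abs_div, abs_mul, abs_pow, abs_of_pos (mul_pos hG hf), Nat.abs_cast]
    have : m⁻¹ * ((n * R ^ (n-1)) / (Nat.factorial n)) = n * R ^ (n-1) / (m * Nat.factorial n) := by field_simp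
    rw [this]
    have := hk n
    gcongr

lemma PP_rec {ν : ℝ} (hν : 0 < ν) (z : ℝ) : PP (ν - 1) z = ν * PP ν z + z * PP (ν + 1) z := by
  have hs0 := PP_summable (ν := ν - 1) (by linarith) z
  have hs1 := PP_summable (ν := ν) (by linarith) z
  have hs2 := PP_summable (ν := ν + 1) (by linarith) z
  unfold PP
  rw [hs0.tsum_eq_zero_add, hs1.tsum_eq_zero_add, mul_add, ← tsum_mul_left, ← tsum_mul_left, add_assoc (ν * _),
    ← Summable.tsum_add]
  · congr 1
    · simp
      rw [Real.Gamma_add_one hν.ne']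
      have := (Real.Gamma_pos_of_pos hν).ne'
      field_simp
    · apply tsum_congr
      intro k
      have hp : 0 < ν + (k:ℝ) + 1 := by have : (0:ℝ) ≤ k := k.cast_nonneg; linarith
      have e0 : ν - 1 + ((k+1:ℕ):ℝ) + 1 = ν + k + 1 := by push_cast; ring
      have e1 : ν + ((k+1:ℕ):ℝ) + 1 = (ν + k + 1) + 1 := by push_cast; ring
      have e2 : ν + 1 + (k:ℝ) + 1 = (ν + k + 1) + 1 := by ring
      rw [e0, e1, e2, Real.Gamma_add_one hp.ne', Nat.factorial_succ]
      have := (Real.Gamma_pos_of_pos hp).ne'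
      have h2 : ((k + 1 : ℕ) : ℝ) ≠ 0 := by positivity
      push_cast at h2 ⊢
      field_simp
      ring
  · apply Summable.mul_left
    exact (summable_nat_add_iff 1).2 hs1
  · exact hs2.mul_left z

lemma PP_pos {ν : ℝ} (hν : -1 < ν) {z : ℝ} (hz : 0 ≤ z) : 0 < PP ν z := by
  have hg : ∀ k : ℕ, 0 < Real.Gamma (ν + k + 1) := fun k => Real.Gamma_pos_of_pos (by
    have : (0:ℝ) ≤ k := k.cast_nonneg
    linarith)
  refine (PP_summable hν z).tsum_pos (fun k => ?_) 0 ?_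
  · have := hg k
    positivity
  · have := hg 0
    simp at this ⊢
    exact this

lemma PP_zero (ν : ℝ) : PP ν 0 = (Real.Gamma (ν + 1))⁻¹ := by
  unfold PP
  rw [tsum_eq_single 0]
  · simp
  · intro k hk
    simp [hk]

/-- `j ν t = t^{-ν} I_ν(t)`. -/
noncomputable def jj (ν t : ℝ) : ℝ := (2:ℝ) ^ (-ν) * PP ν (t ^ 2 / 4)

lemma jj_pos {ν : ℝ} (hν : -1 < ν) (t : ℝ) : 0 < jj ν t :=
  mul_pos (by positivity) (PP_pos hν (by positivity))

lemma jj_zero (ν : ℝ) : jj ν 0 = (2:ℝ) ^ (-ν) / Real.Gamma (ν + 1) := by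
  simp [jj, PP_zero, div_eq_mul_inv]

lemma jj_hasDerivAt {ν : ℝ} (hν : -1 < ν) (t : ℝ) : HasDerivAt (jj ν) (t * jj (ν + 1) t) t := by
  have h1 : HasDerivAt (fun t : ℝ => t ^ 2 / 4) (t / 2) t := by
    have := (hasDerivAt_pow 2 t).div_const 4
    refine this.congr_deriv ?_
    norm_num; ring
  have := ((PP_hasDerivAt hν (t ^ 2 / 4)).comp t h1).const_mul ((2:ℝ) ^ (-ν))
  refine this.congr_deriv ?_
  unfold jj
  have : (2:ℝ) ^ (-(ν+1)) = 2 ^ (-ν) / 2 := by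
    rw [neg_add, ← sub_eq_add_neg, Real.rpow_sub_one (by norm_num)]
  rw [this]; ring

lemma jj_rec {ν : ℝ} (hν : 0 < ν) (t : ℝ) : jj (ν - 1) t = 2 * ν * jj ν t + t ^ 2 * jj (ν + 1) t := by
  unfold jj
  rw [PP_rec hν]
  have : (2:ℝ) ^ (-(ν+1)) = 2 ^ (-ν) / 2 := by
    rw [neg_add, ← sub_eq_add_neg, Real.rpow_sub_one (by norm_num)]
  rw [this]
  have : (2:ℝ) ^ (-(ν-1)) = 2 ^ (-ν) * 2 := by
    rw [show -(ν - 1) = -ν + 1 by ring, Real.rpow_add_one (by norm_num)]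
  rw [this]; ring

lemma jj_rec' {ν : ℝ} (hν : -1 < ν) (t : ℝ) :
    t ^ 2 * jj (ν + 1 + 1) t = jj ν t - 2 * (ν + 1) * jj (ν + 1) t := by
  have := jj_rec (ν := ν + 1) (by linarith) t
  rw [add_sub_cancel_right] at this
  linarith

lemma besselI_eq (ν : ℝ) {t : ℝ} (ht : 0 < t) : besselI ν t = t ^ ν * jj ν t := by
  unfold besselI jj PP
  rw [← tsum_mul_left, ← tsum_mul_left]
  apply tsum_congr
  intro k
  have : (t / 2) ^ (ν + 2 * (k:ℝ)) = t ^ ν * (2 ^ (-ν) * (t ^ 2 / 4) ^ k) := by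
    rw [Real.rpow_add (by positivity), Real.div_rpow ht.le (by norm_num), Real.rpow_neg (by norm_num),
      Real.rpow_mul (by positivity), Real.rpow_natCast]
    rw [show (t / 2) ^ (2:ℝ) = t ^ 2 / 4 by rw [Real.rpow_two]; ring]
    ring
  rw [this]; ring

lemma jj_continuous {ν : ℝ} (hν : -1 < ν) : Continuous (jj ν) :=
  continuous_iff_continuousAt.2 fun t => (jj_hasDerivAt hν t).continuousAt

/-- `I_{ν+1} ≤ I_ν`. -/
lemma jj_mono {ν : ℝ} (hν : -1/2 ≤ ν) {t : ℝ} (ht : 0 ≤ t) : t * jj (ν + 1) t ≤ jj ν t := by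
  have h1 : -1 < ν := by linarith
  have h2 : -1 < ν + 1 := by linarith
  let f : ℝ → ℝ := fun t => Real.exp t * (jj ν t - t * jj (ν + 1) t)
  have hd : ∀ t, HasDerivAt f (Real.exp t * ((2 * ν + 1) * jj (ν + 1) t)) t := by
    intro t
    have := (Real.hasDerivAt_exp t).mul ((jj_hasDerivAt h1 t).sub ((hasDerivAt_id t).mul (jj_hasDerivAt h2 t)))
    refine this.congr_deriv ?_
    simp only [Pi.sub_apply, Pi.mul_apply, id]
    have := jj_rec' h1 t
    linear_combination (-Real.exp t) * this
  have hm : MonotoneOn f (Set.Ici 0) := by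
    apply monotoneOn_of_deriv_nonneg (convex_Ici 0)
    · exact fun t _ => (hd t).continuousAt.continuousWithinAt
    · exact fun t _ => (hd t).differentiableAt.differentiableWithinAt
    · intro t _
      rw [(hd t).deriv]
      have := jj_pos h2 t
      have : 0 ≤ 2 * ν + 1 := by linarith
      positivity
  have := hm (Set.mem_Ici.2 le_rfl) (Set.mem_Ici.2 ht) ht
  simp only [f] at this
  have h0 := jj_pos h1 0
  simp only [zero_mul, sub_zero, Real.exp_zero, one_mul] at this
  have h3 : 0 < Real.exp t * (jj ν t - t * jj (ν + 1) t) := h0.trans_le this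
  have := pos_of_mul_pos_right h3 (Real.exp_pos t).le
  linarith

lemma jj_turan {ν : ℝ} (hν : -1/2 < ν) {t : ℝ} (ht : 0 < t) :
    0 ≤ jj ν t ^ 2 - (2 * ν + 1) * jj ν t * jj (ν + 1) t - t ^ 2 * jj (ν + 1) t ^ 2 := by
  have h1 : -1 < ν := by linarith
  have h2 : -1 < ν + 1 := by linarith
  let n : ℝ → ℝ := fun t => jj ν t ^ 2 - (2 * ν + 1) * jj ν t * jj (ν + 1) t - t ^ 2 * jj (ν + 1) t ^ 2
  let f : ℝ → ℝ := fun t => t ^ (2 * ν + 1) * n t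
  have hnc : Continuous n := by
    have := jj_continuous h1
    have := jj_continuous h2
    fun_prop
  have hfc : Continuous f := (Real.continuous_rpow_const (by linarith)).mul hnc
  have hd : ∀ t, 0 < t → HasDerivAt f (t ^ (2 * ν) * ((2 * ν + 1) * (jj ν t * jj (ν + 1) t))) t := by
    intro t ht
    have d1 := jj_hasDerivAt h1 t
    have d2 := jj_hasDerivAt h2 t
    have dn := ((d1.pow 2).sub ((d1.const_mul (2 * ν + 1)).mul d2)).sub ((hasDerivAt_pow 2 t).mul (d2.pow 2))
    have dt := Real.hasDerivAt_rpow_const (x := t) (p := 2 * ν + 1) (Or.inl ht.ne')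
    have := dt.mul dn
    refine this.congr_deriv ?_
    simp only [Pi.sub_apply, Pi.mul_apply, Pi.pow_apply]
    have e : t ^ (2 * ν + 1) = t ^ (2 * ν) * t := Real.rpow_add_one ht.ne' _
    rw [add_sub_cancel_right, e]
    have hr := jj_rec' h1 t
    push_cast
    simp only [pow_one]
    linear_combination (-t ^ (2 * ν) * ((2 * ν + 1) * jj ν t + 2 * t ^ 2 * jj (ν + 1) t)) * hr
  have hm : MonotoneOn f (Set.Ici 0) := by
    apply monotoneOn_of_deriv_nonneg (convex_Ici 0) hfc.continuousOn
    · intro t ht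
      rw [interior_Ici] at ht
      exact (hd t ht).differentiableAt.differentiableWithinAt
    · intro t ht
      rw [interior_Ici] at ht
      rw [(hd t ht).deriv]
      have := jj_pos h2 t
      have := jj_pos h1 t
      have : 0 ≤ 2 * ν + 1 := by linarith
      have := Real.rpow_nonneg (Set.mem_Ioi.1 ht).le (2 * ν)
      positivity
  have := hm (Set.mem_Ici.2 le_rfl) (Set.mem_Ici.2 ht.le) ht.le
  simp only [f] at this
  rw [Real.zero_rpow (by linarith), zero_mul] at this
  have hp := Real.rpow_pos_of_pos ht (2 * ν + 1)
  exact nonneg_of_mul_nonneg_right this hp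

/-- the ratio `I_{ν+1}/I_ν` -/
lemma ratio_mono {ν : ℝ} (hν : -1/2 < ν) :
    MonotoneOn (fun t => t * jj (ν + 1) t / jj ν t) (Set.Ici 0) := by
  have h1 : -1 < ν := by linarith
  have h2 : -1 < ν + 1 := by linarith
  have hd : ∀ t, HasDerivAt (fun t => t * jj (ν + 1) t / jj ν t)
      ((jj ν t ^ 2 - (2 * ν + 1) * jj ν t * jj (ν + 1) t - t ^ 2 * jj (ν + 1) t ^ 2) / jj ν t ^ 2) t := by
    intro t
    have := ((hasDerivAt_id t).mul (jj_hasDerivAt h2 t)).div (jj_hasDerivAt h1 t) (jj_pos h1 t).ne'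
    refine this.congr_deriv ?_
    simp only [Pi.mul_apply, id]
    have hr := jj_rec' h1 t
    congr 1
    linear_combination jj ν t * hr
  apply monotoneOn_of_deriv_nonneg (convex_Ici 0)
  · exact fun t _ => (hd t).continuousAt.continuousWithinAt
  · exact fun t _ => (hd t).differentiableAt.differentiableWithinAt
  · intro t ht
    rw [interior_Ici] at ht
    rw [(hd t).deriv]
    exact div_nonneg (jj_turan hν ht) (by positivity)

/-! ### The function K -/

lemma cosh_ge (u : ℝ) : 1 + u ^ 2 / 2 ≤ Real.cosh u := by
  rw [← Real.cosh_abs, ← sq_abs]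
  have h0 : 0 ≤ |u| / 2 := by positivity
  have h1 : |u| / 2 ≤ Real.sinh (|u| / 2) := Real.self_le_sinh_iff.2 h0
  have h2 : Real.cosh |u| = 1 + 2 * Real.sinh (|u| / 2) ^ 2 := by
    rw [show |u| = 2 * (|u| / 2) by ring, Real.cosh_two_mul, Real.cosh_sq]
    ring_nf
  rw [h2]
  nlinarith

lemma K_bound (ν : ℝ) {t : ℝ} (ht : 0 < t) (u : ℝ) :
    Real.exp (-t * Real.cosh u) * Real.cosh (ν * u) ≤ Real.exp (ν ^ 2 / t) * Real.exp (-(t / 4) * u ^ 2) := by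
  have h1 : Real.cosh (ν * u) ≤ Real.exp (|ν| * |u|) := by
    rw [← Real.cosh_abs, abs_mul, Real.cosh_eq]
    have : Real.exp (-(|ν| * |u|)) ≤ Real.exp (|ν| * |u|) := by
      apply Real.exp_le_exp.2
      have : 0 ≤ |ν| * |u| := by positivity
      linarith
    linarith
  have h2 : |ν| * |u| ≤ ν ^ 2 / t + t / 4 * u ^ 2 := by
    rw [← sq_abs ν, ← sq_abs u]
    have : |ν| ^ 2 / t + t / 4 * |u| ^ 2 - |ν| * |u| = (|ν| - t / 2 * |u|) ^ 2 / t := by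
      field_simp; ring
    have h3 : 0 ≤ (|ν| - t / 2 * |u|) ^ 2 / t := by positivity
    linarith
  have h4 := cosh_ge u
  calc Real.exp (-t * Real.cosh u) * Real.cosh (ν * u)
      ≤ Real.exp (-t * Real.cosh u) * Real.exp (|ν| * |u|) := by gcongr
    _ = Real.exp (-t * Real.cosh u + |ν| * |u|) := by rw [Real.exp_add]
    _ ≤ Real.exp (ν ^ 2 / t + -(t / 4) * u ^ 2) := by
        apply Real.exp_le_exp.2
        nlinarith
    _ = _ := by rw [Real.exp_add]

lemma K_int (ν : ℝ) {t : ℝ} (ht : 0 < t) :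
    Integrable (fun u : ℝ => Real.exp (-t * Real.cosh u) * Real.cosh (ν * u)) := by
  have := (integrable_exp_neg_mul_sq (b := t / 4) (by positivity)).const_mul (Real.exp (ν ^ 2 / t))
  refine this.mono' (by fun_prop) ?_
  refine ae_of_all _ fun u => ?_
  rw [Real.norm_of_nonneg (by have := Real.cosh_pos (ν * u); positivity)]
  exact K_bound ν ht u

lemma K_neg (ν t : ℝ) : besselK (-ν) t = besselK ν t := by
  simp [besselK, neg_mul, Real.cosh_neg]

lemma K_mono {μ ν : ℝ} (h : |μ| ≤ |ν|) {t : ℝ} (ht : 0 < t) : besselK μ t ≤ besselK ν t := by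
  unfold besselK
  apply setIntegral_mono (K_int μ ht).integrableOn (K_int ν ht).integrableOn
  intro u
  have : Real.cosh (μ * u) ≤ Real.cosh (ν * u) := by
    rw [Real.cosh_le_cosh, abs_mul, abs_mul]
    gcongr
  dsimp only
  gcongr

lemma K_pos (ν : ℝ) {t : ℝ} (ht : 0 < t) : 0 < besselK ν t := by
  unfold besselK
  rw [setIntegral_pos_iff_support_of_nonneg_ae]
  · have : Function.support (fun u : ℝ => Real.exp (-t * Real.cosh u) * Real.cosh (ν * u)) = Set.univ := by
      ext u
      simp [(Real.cosh_pos _).ne']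
    rw [this]; simp
  · exact ae_of_all _ fun u => by have := Real.cosh_pos (ν * u); simp only [Pi.zero_apply]; positivity
  · exact (K_int ν ht).integrableOn

lemma K_hasDerivAt (ν : ℝ) {t : ℝ} (ht : 0 < t) :
    HasDerivAt (besselK ν) (-(besselK (ν + 1) t + besselK (ν - 1) t) / 2) t := by
  have hprod : ∀ u : ℝ, Real.cosh u * Real.cosh (ν * u) = (Real.cosh ((ν + 1) * u) + Real.cosh ((ν - 1) * u)) / 2 := by
    intro u
    rw [add_mul, sub_mul, one_mul, Real.cosh_add, Real.cosh_sub]; ring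
  have H := hasDerivAt_integral_of_dominated_loc_of_deriv_le (μ := volume.restrict (Set.Ioi (0:ℝ)))
    (F := fun t u => Real.exp (-t * Real.cosh u) * Real.cosh (ν * u))
    (F' := fun t u => Real.exp (-t * Real.cosh u) * (-Real.cosh u) * Real.cosh (ν * u))
    (x₀ := t) (s := Set.Ioi (t / 2))
    (bound := fun u => (Real.exp (-(t/2) * Real.cosh u) * Real.cosh ((ν + 1) * u) + Real.exp (-(t/2) * Real.cosh u) * Real.cosh ((ν - 1) * u)) / 2)
    (Ioi_mem_nhds (by linarith)) (Eventually.of_forall fun t => by fun_prop) (K_int ν ht).integrableOn (by fun_prop)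
    ?_ ?_ ?_
  · have e : ∫ u in Set.Ioi (0:ℝ), Real.exp (-t * Real.cosh u) * (-Real.cosh u) * Real.cosh (ν * u) =
        -(besselK (ν + 1) t + besselK (ν - 1) t) / 2 := by
      unfold besselK
      rw [← integral_add (K_int _ ht).integrableOn (K_int _ ht).integrableOn, ← integral_neg, ← integral_div]
      congr 1
      ext u
      linear_combination (-Real.exp (-t * Real.cosh u)) * hprod u
    rw [e] at H
    exact H.2
  · refine ae_of_all _ fun u x hx => ?_
    have hc := Real.cosh_pos u
    have hc' := Real.cosh_pos (ν * u)
    rw [norm_mul, norm_mul, norm_neg, Real.norm_of_nonneg hc.le, Real.norm_of_nonneg hc'.le,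
      Real.norm_of_nonneg (Real.exp_pos _).le, mul_assoc, hprod]
    have h1 := Real.cosh_pos ((ν + 1) * u)
    have h2 := Real.cosh_pos ((ν - 1) * u)
    have : Real.exp (-x * Real.cosh u) ≤ Real.exp (-(t/2) * Real.cosh u) := by
      apply Real.exp_le_exp.2
      have := Set.mem_Ioi.1 hx
      nlinarith
    calc _ ≤ Real.exp (-(t/2) * Real.cosh u) * ((Real.cosh ((ν + 1) * u) + Real.cosh ((ν - 1) * u)) / 2) := by gcongr
      _ = _ := by ring
  · exact (((K_int _ (half_pos ht)).add (K_int _ (half_pos ht))).div_const 2).integrableOn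
  · refine ae_of_all _ fun u x hx => ?_
    have : HasDerivAt (fun x : ℝ => -x * Real.cosh u) (-Real.cosh u) x := by
      have := (hasDerivAt_neg x).mul_const (Real.cosh u)
      refine this.congr_deriv (by ring)
    exact this.exp.mul_const _

lemma K_rec (ν : ℝ) {t : ℝ} (ht : 0 < t) :
    t * (besselK (ν + 1) t - besselK (ν - 1) t) = 2 * ν * besselK ν t := by
  have hprod : ∀ u : ℝ, Real.sinh u * Real.sinh (ν * u) = (Real.cosh ((ν + 1) * u) - Real.cosh ((ν - 1) * u)) / 2 := by
    intro u
    rw [add_mul, sub_mul, one_mul, Real.cosh_add, Real.cosh_sub]; ring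
  have hd : ∀ u : ℝ, HasDerivAt (fun u => Real.exp (-t * Real.cosh u) * Real.sinh (ν * u))
      (ν * (Real.exp (-t * Real.cosh u) * Real.cosh (ν * u)) -
        t / 2 * (Real.exp (-t * Real.cosh u) * Real.cosh ((ν + 1) * u) - Real.exp (-t * Real.cosh u) * Real.cosh ((ν - 1) * u))) u := by
    intro u
    have h1 := ((Real.hasDerivAt_cosh u).const_mul (-t)).exp
    have h2 : HasDerivAt (fun u => Real.sinh (ν * u)) (Real.cosh (ν * u) * ν) u := by
      have := ((hasDerivAt_id u).const_mul ν).sinh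
      simpa using this
    refine (h1.mul h2).congr_deriv ?_
    linear_combination (-t * Real.exp (-t * Real.cosh u)) * hprod u
  have hlim : Tendsto (fun u => Real.exp (-t * Real.cosh u) * Real.sinh (ν * u)) atTop (nhds 0) := by
    have hg : Tendsto (fun u : ℝ => Real.exp (ν ^ 2 / t) * Real.exp (-(t / 4) * u ^ 2)) atTop (nhds 0) := by
      rw [← mul_zero (Real.exp (ν ^ 2 / t))]
      apply Tendsto.const_mul
      apply Real.tendsto_exp_atBot.comp
      exact (tendsto_pow_atTop (by norm_num)).const_mul_atTop_of_neg (by linarith)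
    refine squeeze_zero_norm (fun u => ?_) hg
    refine le_trans ?_ (K_bound ν ht u)
    rw [norm_mul, Real.norm_of_nonneg (Real.exp_pos _).le, Real.norm_eq_abs]
    gcongr
    rw [← abs_of_pos (Real.cosh_pos (ν * u))]
    apply sq_le_sq.1
    rw [Real.cosh_sq]; linarith
  have hA : Integrable (fun u : ℝ => t / 2 * (Real.exp (-t * Real.cosh u) * Real.cosh ((ν + 1) * u) -
      Real.exp (-t * Real.cosh u) * Real.cosh ((ν - 1) * u))) :=
    ((K_int (ν + 1) ht).sub (K_int (ν - 1) ht)).const_mul (t / 2)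
  have hi := (((K_int ν ht).const_mul ν).sub (((K_int (ν + 1) ht).sub (K_int (ν - 1) ht)).const_mul (t / 2))).integrableOn (s := Set.Ioi (0:ℝ))
  have := integral_Ioi_of_hasDerivAt_of_tendsto' (a := 0) (fun u _ => hd u) hi hlim
  rw [integral_sub ((K_int ν ht).const_mul ν).integrableOn
    hA.integrableOn,
    integral_const_mul, integral_const_mul,
    integral_sub (K_int (ν + 1) ht).integrableOn (K_int (ν - 1) ht).integrableOn] at this
  simp only [mul_zero, Real.sinh_zero, sub_zero] at this
  unfold besselK
  linarith

lemma K_turan (ν : ℝ) {t : ℝ} (ht : 0 < t) :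
    besselK ν t ^ 2 ≤ besselK (ν - 1) t * besselK (ν + 1) t := by
  have key : ∀ l : ℝ, 0 ≤ l ^ 2 * besselK (ν + 1) t - 2 * l * besselK ν t + besselK (ν - 1) t := by
    intro l
    unfold besselK
    rw [← integral_const_mul, ← integral_const_mul, ← integral_sub, ← integral_add]
    · apply integral_nonneg
      intro u
      have e : l ^ 2 * Real.cosh ((ν + 1) * u) - 2 * l * Real.cosh (ν * u) + Real.cosh ((ν - 1) * u) =
        (Real.exp (ν * u) * (l * Real.exp (u / 2) - Real.exp (-(u / 2))) ^ 2 +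
         Real.exp (-(ν * u)) * (l * Real.exp (-(u / 2)) - Real.exp (u / 2)) ^ 2) / 2 := by
        rw [Real.cosh_eq, Real.cosh_eq, Real.cosh_eq]
        rw [show (ν + 1) * u = ν * u + u / 2 + u / 2 by ring, show (ν - 1) * u = ν * u + -(u / 2) + -(u / 2) by ring]
        simp only [neg_add, neg_neg, Real.exp_add]
        have : Real.exp (u / 2) * Real.exp (-(u / 2)) = 1 := by rw [← Real.exp_add]; simp
        linear_combination (l * (Real.exp (ν * u) + Real.exp (-(ν * u)))) * this
      have : 0 ≤ Real.exp (-t * Real.cosh u) * (l ^ 2 * Real.cosh ((ν + 1) * u) - 2 * l * Real.cosh (ν * u) + Real.cosh ((ν - 1) * u)) := by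
        rw [e]; positivity
      simp only [Pi.zero_apply]
      linarith
    · exact (((K_int (ν + 1) ht).const_mul _).sub ((K_int ν ht).const_mul _)).integrableOn
    · exact (K_int _ ht).integrableOn
    · exact ((K_int (ν + 1) ht).const_mul _).integrableOn
    · exact ((K_int ν ht).const_mul _).integrableOn
  have hp := K_pos (ν + 1) ht
  have := key (besselK ν t / besselK (ν + 1) t)
  have e : (besselK ν t / besselK (ν + 1) t) ^ 2 * besselK (ν + 1) t - 2 * (besselK ν t / besselK (ν + 1) t) * besselK ν t + besselK (ν - 1) t
    = (besselK (ν - 1) t * besselK (ν + 1) t - besselK ν t ^ 2) / besselK (ν + 1) t := by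
    field_simp; ring
  rw [e] at this
  have h3 := mul_nonneg this hp.le
  rw [div_mul_cancel₀ _ hp.ne'] at h3
  linarith

lemma K_measurable (ν : ℝ) : Measurable (besselK ν) := by
  unfold besselK
  apply StronglyMeasurable.measurable
  apply StronglyMeasurable.integral_prod_right
  apply Continuous.stronglyMeasurable
  unfold Function.uncurry
  fun_prop

/-- `k ν t = t^ν K_ν(t)` -/
noncomputable def kk (ν t : ℝ) : ℝ := t ^ ν * besselK ν t

lemma kk_measurable (ν : ℝ) : Measurable (kk ν) := by
  have := K_measurable ν
  unfold kk
  fun_prop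

lemma kk_pos (ν : ℝ) {t : ℝ} (ht : 0 < t) : 0 < kk ν t := mul_pos (Real.rpow_pos_of_pos ht _) (K_pos ν ht)

lemma kk_hasDerivAt (ν : ℝ) {t : ℝ} (ht : 0 < t) : HasDerivAt (kk ν) (-(t * kk (ν - 1) t)) t := by
  have := (Real.hasDerivAt_rpow_const (x := t) (p := ν) (Or.inl ht.ne')).mul (K_hasDerivAt ν ht)
  refine this.congr_deriv ?_
  unfold kk
  have e : t ^ ν = t ^ (ν - 1) * t := by rw [← Real.rpow_add_one ht.ne', sub_add_cancel]
  rw [e]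
  have := K_rec ν ht
  linear_combination (-t ^ (ν - 1) / 2) * this

lemma kk_rec (ν : ℝ) {t : ℝ} (ht : 0 < t) : kk (ν + 1) t = t ^ 2 * kk (ν - 1) t + 2 * ν * kk ν t := by
  unfold kk
  have e : t ^ ν = t ^ (ν - 1) * t := by rw [← Real.rpow_add_one ht.ne', sub_add_cancel]
  have e2 : t ^ (ν + 1) = t ^ (ν - 1) * t * t := by rw [Real.rpow_add_one ht.ne', e]
  rw [e, e2]
  have := K_rec ν ht
  linear_combination (t ^ (ν - 1) * t) * this

lemma kk_mono {ν : ℝ} (hν : -1/2 ≤ ν) {t : ℝ} (ht : 0 < t) : t * kk ν t ≤ kk (ν + 1) t := by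
  unfold kk
  rw [Real.rpow_add_one ht.ne']
  have : besselK ν t ≤ besselK (ν + 1) t := K_mono (by
    rw [abs_of_nonneg (by linarith : 0 ≤ ν + 1)]
    exact abs_le.2 ⟨by linarith, by linarith⟩) ht
  have h2 := Real.rpow_pos_of_pos ht ν
  calc t * (t ^ ν * besselK ν t) = t ^ ν * t * besselK ν t := by ring
    _ ≤ _ := by gcongr

lemma kk_mono' {ν : ℝ} (hν : ν ≤ 1/2) {t : ℝ} (ht : 0 < t) : kk ν t ≤ t * kk (ν - 1) t := by
  unfold kk
  have e : t ^ ν = t ^ (ν - 1) * t := by rw [← Real.rpow_add_one ht.ne', sub_add_cancel]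
  have : besselK ν t ≤ besselK (ν - 1) t := K_mono (by
    rw [abs_of_nonpos (by linarith : ν - 1 ≤ 0)]
    exact abs_le.2 ⟨by linarith, by linarith⟩) ht
  have h2 := Real.rpow_pos_of_pos ht (ν - 1)
  rw [e]
  calc t ^ (ν - 1) * t * besselK ν t ≤ t ^ (ν - 1) * t * besselK (ν - 1) t := by gcongr
    _ = _ := by ring

lemma kk_turan (ν : ℝ) {t : ℝ} (ht : 0 < t) :
    kk ν t ^ 2 ≤ kk (ν - 1) t * kk (ν + 1) t := by
  unfold kk
  have e : t ^ ν = t ^ (ν - 1) * t := by rw [← Real.rpow_add_one ht.ne', sub_add_cancel]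
  have e2 : t ^ (ν + 1) = t ^ (ν - 1) * t * t := by rw [Real.rpow_add_one ht.ne', e]
  rw [e, e2]
  have := K_turan ν ht
  have h2 := Real.rpow_pos_of_pos ht (ν - 1)
  calc (t ^ (ν - 1) * t * besselK ν t) ^ 2 = (t ^ (ν - 1) * t) ^ 2 * besselK ν t ^ 2 := by ring
    _ ≤ (t ^ (ν - 1) * t) ^ 2 * (besselK (ν - 1) t * besselK (ν + 1) t) := by gcongr
    _ = _ := by ring

/-- integrand of the mixture representation -/
noncomputable def mixR (ν t s : ℝ) : ℝ := 1 / 2 * ((2 * s) ^ ν / s) * Real.exp (-s - t ^ 2 / (4 * s))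

lemma K_full (ν : ℝ) {t : ℝ} (ht : 0 < t) :
    Integrable (fun u : ℝ => Real.exp (-t * Real.cosh u) * Real.exp (ν * u)) ∧
    ∫ u : ℝ, Real.exp (-t * Real.cosh u) * Real.exp (ν * u) = 2 * besselK ν t := by
  have hs : Integrable (fun u : ℝ => Real.exp (-t * Real.cosh u) * Real.sinh (ν * u)) := by
    refine (K_int ν ht).mono' (by fun_prop) (ae_of_all _ fun u => ?_)
    rw [norm_mul, Real.norm_of_nonneg (Real.exp_pos _).le, Real.norm_eq_abs]
    gcongr
    rw [← abs_of_pos (Real.cosh_pos (ν * u))]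
    apply sq_le_sq.1
    rw [Real.cosh_sq]; linarith
  have e : (fun u : ℝ => Real.exp (-t * Real.cosh u) * Real.exp (ν * u)) =
      fun u => Real.exp (-t * Real.cosh u) * Real.cosh (ν * u) + Real.exp (-t * Real.cosh u) * Real.sinh (ν * u) := by
    ext u
    rw [← mul_add, Real.cosh_add_sinh]
  rw [e]
  refine ⟨(K_int ν ht).add hs, ?_⟩
  rw [integral_add (K_int ν ht) hs]
  have h0 : ∫ u : ℝ, Real.exp (-t * Real.cosh u) * Real.sinh (ν * u) = 0 := by
    have := integral_neg_eq_self (fun u : ℝ => Real.exp (-t * Real.cosh u) * Real.sinh (ν * u)) volume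
    simp only [Real.cosh_neg, mul_neg, Real.sinh_neg, integral_neg] at this
    linarith
  have h1 : ∫ u : ℝ, Real.exp (-t * Real.cosh u) * Real.cosh (ν * u) = 2 * besselK ν t := by
    have := integral_comp_abs (f := fun u : ℝ => Real.exp (-t * Real.cosh u) * Real.cosh (ν * u))
    unfold besselK
    rw [← this]
    congr 1
    ext u
    rw [Real.cosh_abs, ← Real.cosh_abs (ν * u), ← Real.cosh_abs (ν * |u|)]
    simp [abs_mul]
  rw [h0, h1, add_zero]

lemma kk_mix (ν : ℝ) {t : ℝ} (ht : 0 < t) :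
    IntegrableOn (mixR ν t) (Set.Ioi 0) ∧ ∫ s in Set.Ioi (0:ℝ), mixR ν t s = kk ν t := by
  have himg : (fun u : ℝ => t / 2 * Real.exp u) '' Set.univ = Set.Ioi 0 := by
    ext s
    simp only [Set.image_univ, Set.mem_range, Set.mem_Ioi]
    constructor
    · rintro ⟨u, rfl⟩; positivity
    · intro hs
      refine ⟨Real.log (s / (t / 2)), ?_⟩
      rw [Real.exp_log (by positivity)]
      field_simp
  have hd : ∀ u ∈ Set.univ, HasDerivWithinAt (fun u : ℝ => t / 2 * Real.exp u) (t / 2 * Real.exp u) Set.univ u :=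
    fun u _ => ((Real.hasDerivAt_exp u).const_mul _).hasDerivWithinAt
  have hinj : Set.InjOn (fun u : ℝ => t / 2 * Real.exp u) Set.univ := by
    intro a _ b _ h
    have h' := mul_left_cancel₀ (by positivity : t / 2 ≠ 0) h
    exact Real.exp_injective h'
  have e : ∀ u : ℝ, |t / 2 * Real.exp u| • mixR ν t (t / 2 * Real.exp u) =
      t ^ ν / 2 * (Real.exp (-t * Real.cosh u) * Real.exp (ν * u)) := by
    intro u
    have hp : 0 < t / 2 * Real.exp u := by positivity
    rw [abs_of_pos hp, smul_eq_mul]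
    unfold mixR
    rw [show 2 * (t / 2 * Real.exp u) = t * Real.exp u by ring, Real.mul_rpow ht.le (Real.exp_pos u).le,
      ← Real.exp_mul, mul_comm u ν]
    have : -(t / 2 * Real.exp u) - t ^ 2 / (4 * (t / 2 * Real.exp u)) = -t * Real.cosh u := by
      rw [Real.cosh_eq, Real.exp_neg]
      field_simp
      ring
    rw [this]
    field_simp
  obtain ⟨hi, hv⟩ := K_full ν ht
  constructor
  · rw [← himg, integrableOn_image_iff_integrableOn_abs_deriv_smul MeasurableSet.univ hd hinj]
    simp only [e]
    exact (hi.const_mul _).integrableOn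
  · rw [← himg, integral_image_eq_integral_abs_deriv_smul MeasurableSet.univ hd hinj]
    simp only [e]
    rw [setIntegral_univ, integral_const_mul, hv]
    unfold kk; ring

lemma kk_le {ν : ℝ} (hν : 0 < ν) {t : ℝ} (ht : 0 < t) : kk ν t ≤ 2 ^ ν / 2 * Real.Gamma ν := by
  obtain ⟨hi, hv⟩ := kk_mix ν ht
  rw [← hv, Real.Gamma_eq_integral hν, ← integral_const_mul]
  apply setIntegral_mono_on hi ((Real.GammaIntegral_convergent hν).const_mul _) measurableSet_Ioi
  intro s hs
  have hs : 0 < s := hs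
  unfold mixR
  rw [Real.mul_rpow (by norm_num) hs.le, Real.rpow_sub_one hs.ne']
  have : Real.exp (-s - t ^ 2 / (4 * s)) ≤ Real.exp (-s) := by
    apply Real.exp_le_exp.2
    have : 0 ≤ t ^ 2 / (4 * s) := by positivity
    linarith
  have h2 := Real.rpow_pos_of_pos hs ν
  calc 1 / 2 * (2 ^ ν * s ^ ν / s) * Real.exp (-s - t ^ 2 / (4 * s))
      ≤ 1 / 2 * (2 ^ ν * s ^ ν / s) * Real.exp (-s) := by gcongr
    _ = _ := by ring


lemma wronsk_hasDerivAt {ν : ℝ} (hν : -1/2 < ν) {t : ℝ} (ht : 0 < t) :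
    HasDerivAt (fun t => jj ν t * kk (ν + 1) t + t ^ 2 * jj (ν + 1) t * kk ν t) 0 t := by
  have h1 := jj_hasDerivAt (ν := ν) (by linarith) t
  have h2 := jj_hasDerivAt (ν := ν + 1) (by linarith) t
  have h3 := kk_hasDerivAt ν ht
  have h4 := kk_hasDerivAt (ν + 1) ht
  have h5 := ((h1.mul h4).add (((hasDerivAt_pow 2 t).mul h2).mul h3))
  refine h5.congr_deriv ?_
  have r1 := jj_rec' (ν := ν) (by linarith) t
  have r2 := kk_rec ν ht
  rw [show ν + 1 - 1 = ν by ring]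
  simp only [Pi.mul_apply]
  rw [r2]
  push_cast
  have : t ^ 2 * (t * jj (ν + 1 + 1) t) = t * (jj ν t - 2 * (ν + 1) * jj (ν + 1) t) := by rw [← r1]; ring
  rw [this]
  ring

lemma wronsk {ν : ℝ} (hν : -1/2 < ν) {t : ℝ} (ht : 0 < t) :
    jj ν t * kk (ν + 1) t + t ^ 2 * jj (ν + 1) t * kk ν t ≤ 1 := by
  have hG : 0 < Real.Gamma (ν + 1) := Real.Gamma_pos_of_pos (by linarith)
  have key : ∀ s ∈ Set.Ioo 0 t, jj ν t * kk (ν + 1) t + t ^ 2 * jj (ν + 1) t * kk ν t ≤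
      (2 ^ ν * Real.Gamma (ν + 1)) * (jj ν s + s * jj (ν + 1) s) := by
    intro s hs
    have hs0 : 0 < s := hs.1
    have := constant_of_has_deriv_right_zero (a := s) (b := t)
      (f := fun t => jj ν t * kk (ν + 1) t + t ^ 2 * jj (ν + 1) t * kk ν t)
      (fun x hx => (wronsk_hasDerivAt hν (hs0.trans_le hx.1)).continuousAt.continuousWithinAt)
      (fun x hx => (wronsk_hasDerivAt hν (hs0.trans_le hx.1)).hasDerivWithinAt) t ⟨hs.2.le, le_rfl⟩
    rw [this]
    have a1 := kk_le (ν := ν + 1) (by linarith) hs0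
    have a2 := kk_mono (ν := ν) (by linarith) hs0
    have a3 := jj_pos (ν := ν) (by linarith) s
    have a4 := jj_pos (ν := ν + 1) (by linarith) s
    rw [Real.rpow_add_one (by norm_num)] at a1
    calc jj ν s * kk (ν + 1) s + s ^ 2 * jj (ν + 1) s * kk ν s
        = jj ν s * kk (ν + 1) s + s * jj (ν + 1) s * (s * kk ν s) := by ring
      _ ≤ jj ν s * kk (ν + 1) s + s * jj (ν + 1) s * kk (ν + 1) s := by gcongr
      _ = (jj ν s + s * jj (ν + 1) s) * kk (ν + 1) s := by ring
      _ ≤ (jj ν s + s * jj (ν + 1) s) * (2 ^ ν * 2 / 2 * Real.Gamma (ν + 1)) := by gcongr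
      _ = _ := by ring
  have hc : Continuous (fun s => (2 ^ ν * Real.Gamma (ν + 1)) * (jj ν s + s * jj (ν + 1) s)) := by
    have := jj_continuous (ν := ν) (by linarith)
    have := jj_continuous (ν := ν + 1) (by linarith)
    fun_prop
  have hl : Tendsto (fun s => (2 ^ ν * Real.Gamma (ν + 1)) * (jj ν s + s * jj (ν + 1) s))
      (nhdsWithin 0 (Set.Ioi 0)) (nhds 1) := by
    have h1 := (hc.tendsto 0).mono_left (nhdsWithin_le_nhds (s := Set.Ioi (0:ℝ)))
    have e : (2 ^ ν * Real.Gamma (ν + 1)) * (jj ν 0 + 0 * jj (ν + 1) 0) = 1 := by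
      rw [jj_zero, Real.rpow_neg (by norm_num)]
      have : (0:ℝ) < 2 ^ ν := by positivity
      field_simp
      ring
    rwa [e] at h1
  refine ge_of_tendsto hl ?_
  filter_upwards [Ioo_mem_nhdsGT ht] with s hs using key s hs

lemma jk1_le {ν : ℝ} (hν : -1/2 < ν) {t : ℝ} (ht : 0 < t) : jj ν t * kk (ν + 1) t ≤ 1 := by
  have h := wronsk hν ht
  have a4 := jj_pos (ν := ν + 1) (by linarith) t
  have a5 := kk_pos ν ht
  have : 0 ≤ t ^ 2 * jj (ν + 1) t * kk ν t := by positivity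
  linarith

lemma gauss_int (γ : ℝ) {s : ℝ} (hs : 0 < s) :
    Integrable (fun t : ℝ => Real.exp (γ * t - t ^ 2 / (4 * s))) ∧
    ∫ t : ℝ, Real.exp (γ * t - t ^ 2 / (4 * s)) = Real.sqrt (4 * π * s) * Real.exp (γ ^ 2 * s) := by
  have e : (fun t : ℝ => Real.exp (γ * t - t ^ 2 / (4 * s))) =
      fun t => Real.exp (γ ^ 2 * s) * Real.exp (-(1 / (4 * s)) * (t - 2 * s * γ) ^ 2) := by
    ext t
    rw [← Real.exp_add]
    congr 1
    field_simp
    ring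
  have hb : 0 < 1 / (4 * s) := by positivity
  rw [e]
  constructor
  · exact ((integrable_exp_neg_mul_sq hb).comp_sub_right (2 * s * γ)).const_mul _
  · rw [integral_const_mul, integral_sub_right_eq_self (fun t => Real.exp (-(1 / (4 * s)) * t ^ 2)) (2 * s * γ),
      integral_gaussian, mul_comm]
    congr 2
    field_simp

lemma total_int {ν γ : ℝ} (hν : -1/2 < ν) (hγ : |γ| < 1) :
    Integrable (fun t : ℝ => Real.exp (γ * t) * kk ν |t|) ∧
    ∫ t : ℝ, Real.exp (γ * t) * kk ν |t| =
      2 ^ ν * Real.sqrt π * (1 / (1 - γ ^ 2)) ^ (ν + 1/2) * Real.Gamma (ν + 1/2) := by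
  have hγ2 : 0 < 1 - γ ^ 2 := by
    have := (sq_lt_one_iff_abs_lt_one γ).2 hγ; linarith
  set F : ℝ × ℝ → ℝ := fun z => Real.exp (γ * z.1) * mixR ν z.1 z.2 with hF
  have eF : ∀ t s : ℝ, F (t, s) = (1 / 2 * ((2 * s) ^ ν / s) * Real.exp (-s)) * Real.exp (γ * t - t ^ 2 / (4 * s)) := by
    intro t s
    simp only [hF, mixR]
    rw [show -s - t ^ 2 / (4 * s) = -s + - (t ^ 2 / (4 * s)) by ring,
      show γ * t - t ^ 2 / (4 * s) = γ * t + - (t ^ 2 / (4 * s)) by ring, Real.exp_add, Real.exp_add]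
    ring
  have hpos : ∀ t s : ℝ, 0 < s → 0 ≤ F (t, s) := by
    intro t s hs; rw [eF]; positivity
  have hm : Measurable F := by
    simp only [hF]; unfold mixR
    fun_prop
  have hin : ∀ s : ℝ, 0 < s → ∫ t, F (t, s) =
      2 ^ ν * Real.sqrt π * (s ^ (ν + 1/2 - 1) * Real.exp (-((1 - γ ^ 2) * s))) := by
    intro s hs
    simp only [eF]
    rw [integral_const_mul, (gauss_int γ hs).2, Real.mul_rpow (by norm_num) hs.le,
      show 4 * π * s = (2 * 2) * (π * s) by ring, Real.sqrt_mul (by norm_num), Real.sqrt_mul_self (by norm_num),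
      Real.sqrt_mul Real.pi_pos.le, Real.sqrt_eq_rpow s, Real.rpow_sub_one hs.ne', Real.rpow_add hs,
      show -((1 - γ ^ 2) * s) = -s + γ ^ 2 * s by ring, Real.exp_add]
    ring
  have hGi : IntegrableOn (fun s : ℝ => 2 ^ ν * Real.sqrt π * (s ^ (ν + 1/2 - 1) * Real.exp (-((1 - γ ^ 2) * s)))) (Set.Ioi 0) := by
    apply Integrable.const_mul
    have := integrableOn_rpow_mul_exp_neg_mul_rpow (p := 1) (s := ν + 1/2 - 1) (b := 1 - γ ^ 2) (by linarith) one_pos hγ2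
    simp only [Real.rpow_one, neg_mul] at this; exact this
  have hFi : Integrable F ((volume : Measure ℝ).prod (volume.restrict (Set.Ioi (0:ℝ)))) := by
    rw [integrable_prod_iff' hm.aestronglyMeasurable]
    constructor
    · filter_upwards [ae_restrict_mem measurableSet_Ioi] with s hs
      simp only [eF]
      exact (gauss_int γ hs).1.const_mul _
    · refine (integrable_congr ?_).1 hGi
      filter_upwards [ae_restrict_mem measurableSet_Ioi] with s hs
      rw [← hin s hs]
      apply integral_congr_ae
      filter_upwards with t
      rw [Real.norm_of_nonneg (hpos t s hs)]
  have hout : (fun t : ℝ => ∫ s in Set.Ioi (0:ℝ), F (t, s)) =ᵐ[volume] fun t => Real.exp (γ * t) * kk ν |t| := by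
    have : ∀ᵐ t : ℝ, t ≠ 0 := by
      simp [ae_iff, measure_singleton]
    filter_upwards [this] with t ht
    simp only [hF]
    rw [integral_const_mul, ← (kk_mix ν (abs_pos.2 ht)).2]
    simp only [mixR, sq_abs]
  constructor
  · exact hFi.integral_prod_left.congr hout
  · rw [← integral_congr_ae hout, integral_integral_swap hFi]
    rw [setIntegral_congr_fun measurableSet_Ioi (g := fun s => 2 ^ ν * Real.sqrt π * (s ^ (ν + 1/2 - 1) * Real.exp (-((1 - γ ^ 2) * s)))) (fun s hs => hin s hs)]
    rw [integral_const_mul, Real.integral_rpow_mul_exp_neg_mul_Ioi (by linarith) hγ2]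
    ring

noncomputable def XX (γ ν y : ℝ) : ℝ := ∫ t in (0:ℝ)..y, Real.exp (γ * t) * t ^ (2 * ν) * jj ν t

noncomputable def PhiI (γ ν y : ℝ) : ℝ := ∫ t in Set.Ioi y, Real.exp (γ * t) * kk ν t

lemma X_intervalIntegrable {γ ν : ℝ} (hν : -1/2 < ν) (a b : ℝ) :
    IntervalIntegrable (fun t => Real.exp (γ * t) * t ^ (2 * ν) * jj ν t) volume a b := by
  have h1 : IntervalIntegrable (fun t : ℝ => t ^ (2 * ν)) volume a b :=
    intervalIntegral.intervalIntegrable_rpow' (by linarith)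
  have h2 : Continuous (fun t : ℝ => Real.exp (γ * t)) := by fun_prop
  exact (h1.continuousOn_mul h2.continuousOn).mul_continuousOn (jj_continuous (by linarith)).continuousOn

lemma X_nonneg {γ ν y : ℝ} (hν : -1/2 < ν) (hy : 0 < y) : 0 ≤ XX γ ν y := by
  apply intervalIntegral.integral_nonneg hy.le
  intro t ht
  have := jj_pos (ν := ν) (by linarith) t
  have := Real.rpow_nonneg ht.1 (2 * ν)
  positivity

lemma X_le {γ ν y c : ℝ} (hν : -1/2 < ν) (hy : 0 < y) (E E' : ℝ → ℝ) (hE : ContinuousOn E (Set.Icc 0 y))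
    (hE0 : E 0 = 0) (hE' : ∀ t ∈ Set.Ioo 0 y, HasDerivAt E (E' t) t)
    (hc : ∀ t ∈ Set.Ioo 0 y, c * (Real.exp (γ * t) * t ^ (2 * ν) * jj ν t) ≤ E' t) :
    c * XX γ ν y ≤ E y := by
  have hi := (X_intervalIntegrable (γ := γ) hν 0 y).const_mul c
  have := intervalIntegral.integral_le_sub_of_hasDeriv_right_of_le hy.le hE
    (fun x hx => (hE' x hx).hasDerivWithinAt)
    ((intervalIntegrable_iff_integrableOn_Icc_of_le hy.le).1 hi) hc
  rw [hE0, sub_zero, intervalIntegral.integral_const_mul] at this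
  exact this

lemma coef_le {γ ν y : ℝ} (hν : -1/2 < ν) (hγ : |γ| < 1) (hy : 0 < y) :
    0 ≤ kk (ν + 1) y + γ * y * kk ν y ∧ (1 - γ) * (kk (ν + 1) y + γ * y * kk ν y) ≤ 2 * kk (ν + 1) y := by
  obtain ⟨g1, g2⟩ := abs_lt.1 hγ
  have h1 := kk_mono (ν := ν) (by linarith) hy
  have h2 : 0 < y * kk ν y := mul_pos hy (kk_pos ν hy)
  have h3 := kk_pos (ν + 1) hy
  constructor
  · nlinarith
  · rcases le_total 0 γ with h | h
    · have : kk (ν + 1) y + γ * y * kk ν y ≤ (1 + γ) * kk (ν + 1) y := by nlinarith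
      have h5 : (1 - γ) * (kk (ν + 1) y + γ * y * kk ν y) ≤ (1 - γ) * ((1 + γ) * kk (ν + 1) y) :=
        mul_le_mul_of_nonneg_left this (by linarith)
      nlinarith [mul_nonneg (sq_nonneg γ) h3.le]
    · have : kk (ν + 1) y + γ * y * kk ν y ≤ kk (ν + 1) y := by nlinarith
      have h5 : (1 - γ) * (kk (ν + 1) y + γ * y * kk ν y) ≤ (1 - γ) * (kk (ν + 1) y) :=
        mul_le_mul_of_nonneg_left this (by linarith)
      nlinarith

lemma T1_hi {γ ν y : ℝ} (hν : 1/2 ≤ ν) (hγ : |γ| < 1) (hy : 0 < y) :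
    (1 - γ ^ 2) * (kk (ν + 1) y + γ * y * kk ν y) * XX γ ν y ≤ 2 * (Real.exp (γ * y) * y ^ (2 * ν)) := by
  obtain ⟨g1, g2⟩ := abs_lt.1 hγ
  have hν' : -1/2 < ν := by linarith
  have hX : (1 + γ) * XX γ ν y ≤ Real.exp (γ * y) * y ^ (2 * ν) * jj ν y := by
    refine X_le hν' hy (fun t => Real.exp (γ * t) * t ^ (2 * ν) * jj ν t)
      (fun t => Real.exp (γ * t) * t ^ (2 * ν) * (γ * jj ν t + jj (ν - 1) t / t)) ?_ ?_ ?_ ?_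
    · have h1 : ContinuousOn (fun t : ℝ => t ^ (2 * ν)) (Set.Icc 0 y) :=
        continuousOn_id.rpow_const (fun x hx => Or.inr (by linarith))
      have h2 : Continuous (fun t : ℝ => Real.exp (γ * t)) := by fun_prop
      exact (h2.continuousOn.mul h1).mul (jj_continuous (by linarith)).continuousOn
    · rw [Real.zero_rpow (by linarith)]; ring
    · intro t ht
      have ht0 : 0 < t := ht.1
      have h1 : HasDerivAt (fun t : ℝ => Real.exp (γ * t)) (Real.exp (γ * t) * γ) t := by
        simpa using ((hasDerivAt_id t).const_mul γ).exp
      have h2 := Real.hasDerivAt_rpow_const (x := t) (p := 2 * ν) (Or.inl ht0.ne')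
      have h3 := jj_hasDerivAt (ν := ν) (by linarith) t
      refine ((h1.mul h2).mul h3).congr_deriv ?_
      simp only [Pi.mul_apply]
      rw [jj_rec (by linarith), Real.rpow_sub_one ht0.ne']
      field_simp
      ring
    · intro t ht
      have ht0 : 0 < t := ht.1
      have h1 := jj_mono (ν := ν - 1) (by linarith) ht0.le
      rw [sub_add_cancel] at h1
      have h2 : jj ν t ≤ jj (ν - 1) t / t := by rw [le_div_iff₀ ht0]; linarith
      have h3 : 0 < Real.exp (γ * t) * t ^ (2 * ν) := by positivity
      have := mul_le_mul_of_nonneg_left h2 h3.le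
      nlinarith
  obtain ⟨c1, c2⟩ := coef_le hν' hγ hy
  have hP : 0 < Real.exp (γ * y) * y ^ (2 * ν) := by positivity
  have hj := jj_pos (ν := ν) (by linarith) y
  have hw := jk1_le hν' hy
  calc (1 - γ ^ 2) * (kk (ν + 1) y + γ * y * kk ν y) * XX γ ν y
      = ((1 - γ) * (kk (ν + 1) y + γ * y * kk ν y)) * ((1 + γ) * XX γ ν y) := by ring
    _ ≤ ((1 - γ) * (kk (ν + 1) y + γ * y * kk ν y)) * (Real.exp (γ * y) * y ^ (2 * ν) * jj ν y) :=
        mul_le_mul_of_nonneg_left hX (mul_nonneg (by linarith) c1)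
    _ ≤ (2 * kk (ν + 1) y) * (Real.exp (γ * y) * y ^ (2 * ν) * jj ν y) :=
        mul_le_mul_of_nonneg_right c2 (by positivity)
    _ = 2 * (Real.exp (γ * y) * y ^ (2 * ν)) * (jj ν y * kk (ν + 1) y) := by ring
    _ ≤ 2 * (Real.exp (γ * y) * y ^ (2 * ν)) * 1 := mul_le_mul_of_nonneg_left hw (by positivity)
    _ = _ := by ring

lemma T1_lo {γ ν y : ℝ} (hν : -1/2 < ν) (hν2 : ν ≤ 1/2) (hγ : |γ| < 1) (hy : 0 < y) :
    (1 - γ ^ 2) * (kk (ν + 1) y + γ * y * kk ν y) * XX γ ν y ≤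
      8 / (2 * ν + 1) * (Real.exp (γ * y) * y ^ (2 * ν)) := by
  obtain ⟨g1, g2⟩ := abs_lt.1 hγ
  have hε : 0 < 1 + γ := by linarith
  have hr : 0 < 2 * ν + 1 := by linarith
  have hX : (2 * ν + 1) / 2 * XX γ ν y ≤
      Real.exp (γ * y) * y ^ (2 * ν + 1) * (jj ν y + y * jj (ν + 1) y) / (1 + (1 + γ) * y) := by
    refine X_le hν hy (fun t => Real.exp (γ * t) * t ^ (2 * ν + 1) * (jj ν t + t * jj (ν + 1) t) / (1 + (1 + γ) * t))
      (fun t => Real.exp (γ * t) * t ^ (2 * ν) * (((2 * ν + 1) * jj ν t * (1 + (1 + γ) * t)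
        + ((1 + γ) * t) ^ 2 * (jj ν t + t * jj (ν + 1) t)) / (1 + (1 + γ) * t) ^ 2)) ?_ ?_ ?_ ?_
    · have h1 : ContinuousOn (fun t : ℝ => t ^ (2 * ν + 1)) (Set.Icc 0 y) :=
        continuousOn_id.rpow_const (fun x hx => Or.inr (by linarith))
      have h2 : Continuous (fun t : ℝ => Real.exp (γ * t)) := by fun_prop
      have h3 : Continuous (fun t : ℝ => jj ν t + t * jj (ν + 1) t) := by
        have := jj_continuous (ν := ν) (by linarith)
        have := jj_continuous (ν := ν + 1) (by linarith)
        fun_prop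
      have h4 : Continuous (fun t : ℝ => 1 + (1 + γ) * t) := by fun_prop
      refine ((h2.continuousOn.mul h1).mul h3.continuousOn).div h4.continuousOn ?_
      intro t ht
      have : 0 ≤ (1 + γ) * t := mul_nonneg hε.le ht.1
      positivity
    · rw [Real.zero_rpow (by linarith)]; ring
    · intro t ht
      have ht0 : 0 < t := ht.1
      have h1 : HasDerivAt (fun t : ℝ => Real.exp (γ * t)) (Real.exp (γ * t) * γ) t := by
        simpa using ((hasDerivAt_id t).const_mul γ).exp
      have h2 := Real.hasDerivAt_rpow_const (x := t) (p := 2 * ν + 1) (Or.inl ht0.ne')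
      have h3 := jj_hasDerivAt (ν := ν) (by linarith) t
      have h4 := jj_hasDerivAt (ν := ν + 1) (by linarith) t
      have h5 : HasDerivAt (fun t => jj ν t + t * jj (ν + 1) t)
          (jj ν t + t * jj (ν + 1) t - (2 * ν + 1) * jj (ν + 1) t) t := by
        refine (h3.add ((hasDerivAt_id t).mul h4)).congr_deriv ?_
        have := jj_rec' (ν := ν) (by linarith) t
        simp only [id]
        linear_combination this
      have h6 : HasDerivAt (fun t => 1 + (1 + γ) * t) (1 + γ) t := by
        simpa using ((hasDerivAt_id t).const_mul (1 + γ)).const_add 1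
      have hne : 1 + (1 + γ) * t ≠ 0 := by positivity
      refine (((h1.mul h2).mul h5).div h6 hne).congr_deriv ?_
      simp only [Pi.mul_apply]
      rw [show 2 * ν + 1 - 1 = 2 * ν by ring, Real.rpow_add_one ht0.ne']
      field_simp
      ring
    · intro t ht
      have ht0 : 0 < t := ht.1
      have hS : 0 < (1 + γ) * t := by positivity
      set S := (1 + γ) * t
      have hj := jj_pos (ν := ν) (by linarith) t
      have hj1 := jj_pos (ν := ν + 1) (by linarith) t
      have h1 : (2 * ν + 1) / 2 * jj ν t ≤
          ((2 * ν + 1) * jj ν t * (1 + S) + S ^ 2 * (jj ν t + t * jj (ν + 1) t)) / (1 + S) ^ 2 := by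
        rw [le_div_iff₀ (by positivity)]
        have : 0 ≤ S ^ 2 * (t * jj (ν + 1) t) := by positivity
        have h7 : 0 ≤ jj ν t * ((2 * ν + 1) / 2 + S ^ 2 * (1/2 - ν)) := by
          have : 0 ≤ S ^ 2 * (1/2 - ν) := mul_nonneg (sq_nonneg _) (by linarith)
          positivity
        nlinarith
      have h3 : 0 < Real.exp (γ * t) * t ^ (2 * ν) := by positivity
      have := mul_le_mul_of_nonneg_left h1 h3.le
      calc _ = Real.exp (γ * t) * t ^ (2 * ν) * ((2 * ν + 1) / 2 * jj ν t) := by ring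
        _ ≤ _ := this
  obtain ⟨c1, c2⟩ := coef_le hν hγ hy
  have hP : 0 < Real.exp (γ * y) * y ^ (2 * ν) := by positivity
  set P := Real.exp (γ * y) * y ^ (2 * ν) with hPd
  have hj := jj_pos (ν := ν) (by linarith) y
  have hj1 := jj_pos (ν := ν + 1) (by linarith) y
  have hw := jk1_le hν hy
  have hm := jj_mono (ν := ν) (by linarith) hy.le
  have hk := kk_pos (ν + 1) hy
  have hX2 : (1 + γ) * XX γ ν y ≤ 2 / (2 * ν + 1) * P * (2 * jj ν y) := by
    have hs : jj ν y + y * jj (ν + 1) y ≤ 2 * jj ν y := by linarith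
    have e1 : XX γ ν y ≤ 2 / (2 * ν + 1) * (P * y * (jj ν y + y * jj (ν + 1) y) / (1 + (1 + γ) * y)) := by
      rw [Real.rpow_add_one hy.ne', ← mul_assoc, ← hPd] at hX
      have := mul_le_mul_of_nonneg_left hX (by positivity : 0 ≤ 2 / (2 * ν + 1))
      calc XX γ ν y = 2 / (2 * ν + 1) * ((2 * ν + 1) / 2 * XX γ ν y) := by field_simp
        _ ≤ _ := this
    have hq : (1 + γ) * y / (1 + (1 + γ) * y) ≤ 1 := by
      rw [div_le_one (by positivity)]; linarith
    calc (1 + γ) * XX γ ν y ≤ (1 + γ) * (2 / (2 * ν + 1) * (P * y * (jj ν y + y * jj (ν + 1) y) / (1 + (1 + γ) * y))) :=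
          mul_le_mul_of_nonneg_left e1 hε.le
      _ = 2 / (2 * ν + 1) * P * (jj ν y + y * jj (ν + 1) y) * ((1 + γ) * y / (1 + (1 + γ) * y)) := by ring
      _ ≤ 2 / (2 * ν + 1) * P * (jj ν y + y * jj (ν + 1) y) * 1 :=
          mul_le_mul_of_nonneg_left hq (by positivity)
      _ ≤ 2 / (2 * ν + 1) * P * (2 * jj ν y) := by
          rw [mul_one]; exact mul_le_mul_of_nonneg_left hs (by positivity)
  calc (1 - γ ^ 2) * (kk (ν + 1) y + γ * y * kk ν y) * XX γ ν y
      = ((1 - γ) * (kk (ν + 1) y + γ * y * kk ν y)) * ((1 + γ) * XX γ ν y) := by ring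
    _ ≤ ((1 - γ) * (kk (ν + 1) y + γ * y * kk ν y)) * (2 / (2 * ν + 1) * P * (2 * jj ν y)) :=
        mul_le_mul_of_nonneg_left hX2 (mul_nonneg (by linarith) c1)
    _ ≤ (2 * kk (ν + 1) y) * (2 / (2 * ν + 1) * P * (2 * jj ν y)) :=
        mul_le_mul_of_nonneg_right c2 (by positivity)
    _ = 8 / (2 * ν + 1) * P * (jj ν y * kk (ν + 1) y) := by ring
    _ ≤ 8 / (2 * ν + 1) * P * 1 := mul_le_mul_of_nonneg_left hw (by positivity)
    _ = _ := by ring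

lemma Phi_integrable {γ ν y : ℝ} (hν : -1/2 < ν) (hγ : |γ| < 1) (hy : 0 ≤ y) :
    IntegrableOn (fun t => Real.exp (γ * t) * kk ν t) (Set.Ioi y) := by
  refine ((total_int hν hγ).1.integrableOn (s := Set.Ioi y)).congr_fun ?_ measurableSet_Ioi
  intro t ht
  simp only
  rw [abs_of_pos (hy.trans_lt ht)]

lemma Phi_nonneg {γ ν y : ℝ} (hy : 0 ≤ y) : 0 ≤ PhiI γ ν y := by
  apply setIntegral_nonneg measurableSet_Ioi
  intro t ht
  have := kk_pos ν (hy.trans_lt ht)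
  positivity

lemma Phi_le_total {γ ν y : ℝ} (hν : -1/2 < ν) (hγ : |γ| < 1) (hy : 0 ≤ y) :
    PhiI γ ν y ≤ 2 ^ ν * Real.sqrt π * (1 / (1 - γ ^ 2)) ^ (ν + 1/2) * Real.Gamma (ν + 1/2) := by
  rw [← (total_int hν hγ).2]
  have : PhiI γ ν y = ∫ t in Set.Ioi y, Real.exp (γ * t) * kk ν |t| := by
    apply setIntegral_congr_fun measurableSet_Ioi
    intro t ht
    simp only
    rw [abs_of_pos (hy.trans_lt ht)]
  rw [this]
  apply setIntegral_le_integral (total_int hν hγ).1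
  have : ∀ᵐ t : ℝ, t ≠ 0 := by simp [ae_iff, measure_singleton]
  filter_upwards [this] with t ht
  have := kk_pos ν (abs_pos.2 ht)
  simp only [Pi.zero_apply]
  positivity

lemma ek_hasDerivAt (γ ν : ℝ) {t : ℝ} (ht : 0 < t) : HasDerivAt (fun t => Real.exp (γ * t) * kk ν t)
    (Real.exp (γ * t) * (γ * kk ν t - t * kk (ν - 1) t)) t := by
  have h1 : HasDerivAt (fun t : ℝ => Real.exp (γ * t)) (Real.exp (γ * t) * γ) t := by
    simpa using ((hasDerivAt_id t).const_mul γ).exp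
  refine (h1.mul (kk_hasDerivAt ν ht)).congr_deriv ?_
  ring

lemma Phi_le {γ ν y c : ℝ} (hν : -1/2 < ν) (hγ : |γ| < 1) (hy : 0 < y)
    (hc : ∀ t, y ≤ t → c * kk ν t ≤ t * kk (ν - 1) t - γ * kk ν t) :
    c * PhiI γ ν y ≤ Real.exp (γ * y) * kk ν y := by
  have hi := Phi_integrable hν hγ hy.le
  have ht := (intervalIntegral_tendsto_integral_Ioi y hi tendsto_id).const_mul c
  refine le_of_tendsto ht ?_
  filter_upwards [eventually_ge_atTop y] with Y hY
  have hcont : ContinuousOn (fun t => -(Real.exp (γ * t) * kk ν t)) (Set.Icc y Y) :=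
    fun t ht => ((ek_hasDerivAt γ ν (hy.trans_le ht.1)).neg).continuousAt.continuousWithinAt
  have hint : IntegrableOn (fun t => c * (Real.exp (γ * t) * kk ν t)) (Set.Icc y Y) := by
    have := (hcont.neg.const_mul c).integrableOn_Icc (μ := volume)
    simpa using this
  have := intervalIntegral.integral_le_sub_of_hasDeriv_right_of_le hY hcont
    (g' := fun t => -(Real.exp (γ * t) * (γ * kk ν t - t * kk (ν - 1) t)))
    (fun x hx => ((ek_hasDerivAt γ ν (hy.trans hx.1)).neg).hasDerivWithinAt) hint ?_
  · rw [intervalIntegral.integral_const_mul] at this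
    have hk := kk_pos ν (hy.trans_le hY)
    have : 0 < Real.exp (γ * Y) * kk ν Y := by positivity
    simp only [id]
    linarith
  · intro x hx
    have := mul_le_mul_of_nonneg_left (hc x hx.1.le) (Real.exp_pos (γ * x)).le
    nlinarith

lemma T2_lo {γ ν y : ℝ} (hν : -1/2 < ν) (hν2 : ν ≤ 1/2) (hγ : |γ| < 1) (hy : 0 < y) :
    (1 - γ ^ 2) * (y * |y * jj (ν + 1) y - γ * jj ν y|) * PhiI γ ν y ≤ 2 * Real.exp (γ * y) := by
  obtain ⟨g1, g2⟩ := abs_lt.1 hγ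
  have h1 : (1 - γ) * PhiI γ ν y ≤ Real.exp (γ * y) * kk ν y := by
    apply Phi_le hν hγ hy
    intro t ht
    have := kk_mono' hν2 (hy.trans_le ht)
    linarith
  have hj := jj_pos (ν := ν) (by linarith) y
  have hj1 := jj_pos (ν := ν + 1) (by linarith) y
  have hm := jj_mono (ν := ν) (by linarith) hy.le
  have hm0 : 0 < y * jj (ν + 1) y := by positivity
  have hw := jk1_le hν hy
  have hk := kk_pos ν hy
  have hkm := kk_mono (ν := ν) (by linarith) hy
  have h2 : (1 + γ) * |y * jj (ν + 1) y - γ * jj ν y| ≤ 2 * jj ν y := by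
    rcases le_total 0 γ with h | h
    · have : |y * jj (ν + 1) y - γ * jj ν y| ≤ jj ν y := by
        rw [abs_le]; constructor <;> nlinarith
      have := mul_le_mul_of_nonneg_left this (by linarith : 0 ≤ 1 + γ)
      nlinarith
    · have : |y * jj (ν + 1) y - γ * jj ν y| ≤ (1 - γ) * jj ν y := by
        rw [abs_le]; constructor <;> nlinarith
      have := mul_le_mul_of_nonneg_left this (by linarith : 0 ≤ 1 + γ)
      nlinarith [mul_nonneg (sq_nonneg γ) hj.le]
  have hP := Phi_nonneg (γ := γ) (ν := ν) hy.le
  calc _ = ((1 + γ) * |y * jj (ν + 1) y - γ * jj ν y|) * (y * ((1 - γ) * PhiI γ ν y)) := by ring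
    _ ≤ (2 * jj ν y) * (y * (Real.exp (γ * y) * kk ν y)) := by
        apply mul_le_mul h2 (mul_le_mul_of_nonneg_left h1 hy.le) _ (by positivity)
        exact mul_nonneg hy.le (mul_nonneg (by linarith) hP)
    _ = 2 * Real.exp (γ * y) * (jj ν y * (y * kk ν y)) := by ring
    _ ≤ 2 * Real.exp (γ * y) * (jj ν y * kk (ν + 1) y) := by gcongr
    _ ≤ 2 * Real.exp (γ * y) * 1 := by gcongr
    _ = _ := by ring

lemma gamma_half {ν : ℝ} (hν : 0 < ν) : ν * Real.Gamma (ν + 1/2) ≤ Real.sqrt ν * Real.Gamma (ν + 1) := by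
  have h := Real.Gamma_mul_add_mul_le_rpow_Gamma_mul_rpow_Gamma (s := ν) (t := ν + 1) (a := 1/2) (b := 1/2)
    hν (by linarith) (by norm_num) (by norm_num) (by norm_num)
  rw [show 1/2 * ν + 1/2 * (ν + 1) = ν + 1/2 by ring, ← Real.sqrt_eq_rpow, ← Real.sqrt_eq_rpow] at h
  have hG : 0 < Real.Gamma ν := Real.Gamma_pos_of_pos hν
  have e : Real.Gamma (ν + 1) = ν * Real.Gamma ν := Real.Gamma_add_one hν.ne'
  rw [e] at h ⊢
  rw [Real.sqrt_mul hν.le] at h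
  have e2 : Real.sqrt (Real.Gamma ν) * (Real.sqrt ν * Real.sqrt (Real.Gamma ν)) = Real.sqrt ν * Real.Gamma ν := by
    rw [mul_left_comm, Real.mul_self_sqrt hG.le]
  rw [e2] at h
  calc ν * Real.Gamma (ν + 1/2) ≤ ν * (Real.sqrt ν * Real.Gamma ν) := mul_le_mul_of_nonneg_left h hν.le
    _ = _ := by ring

lemma T2_regA {γ ν y : ℝ} (hν : 1/2 ≤ ν) (hγ : |γ| < 1) (hy : 0 < y)
    (hA : y * jj (ν + 1) y ≤ γ * jj ν y) :
    (1 - γ ^ 2) * (y * |y * jj (ν + 1) y - γ * jj ν y|) * PhiI γ ν y ≤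
      2 * (Real.sqrt (π * ν) * (1 / (1 - γ ^ 2)) ^ (ν - 1/2)) * Real.exp (γ * y) := by
  obtain ⟨g1, g2⟩ := abs_lt.1 hγ
  have hν' : -1/2 < ν := by linarith
  have hγ2 : 0 < 1 - γ ^ 2 := by
    have := (sq_lt_one_iff_abs_lt_one γ).2 hγ; linarith
  have hjp : ∀ t, 0 < jj ν t := fun t => jj_pos (by linarith) t
  have hN : Real.exp (-(γ * y)) * jj ν y ≤ jj ν 0 := by
    have hd : ∀ t, HasDerivAt (fun t => Real.exp (-(γ * t)) * jj ν t)
        (Real.exp (-(γ * t)) * (t * jj (ν + 1) t - γ * jj ν t)) t := by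
      intro t
      have h1 : HasDerivAt (fun t : ℝ => Real.exp (-(γ * t))) (Real.exp (-(γ * t)) * (-γ)) t := by
        simpa using (((hasDerivAt_id t).const_mul γ).neg).exp
      refine (h1.mul (jj_hasDerivAt (ν := ν) (by linarith) t)).congr_deriv ?_
      ring
    have := antitoneOn_of_deriv_nonpos (convex_Icc 0 y) (f := fun t => Real.exp (-(γ * t)) * jj ν t)
      (fun t _ => (hd t).continuousAt.continuousWithinAt) (fun t _ => (hd t).differentiableAt.differentiableWithinAt)
      (by
        intro t ht
        rw [interior_Icc] at ht
        rw [(hd t).deriv]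
        have h1 := ratio_mono hν' (a := t) (b := y) ht.1.le hy.le ht.2.le
        simp only at h1
        have h2 : y * jj (ν + 1) y / jj ν y ≤ γ := by rw [div_le_iff₀ (hjp y)]; exact hA
        have h3 := h1.trans h2
        rw [div_le_iff₀ (hjp t)] at h3
        exact mul_nonpos_of_nonneg_of_nonpos (Real.exp_pos _).le (by linarith))
    have := this ⟨le_rfl, hy.le⟩ ⟨hy.le, le_rfl⟩ hy.le
    simpa using this
  have hm := jj_mono (ν := ν - 1) (by linarith) hy.le
  rw [sub_add_cancel, jj_rec (by linarith)] at hm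
  have hj := hjp y
  have h1 : y * |y * jj (ν + 1) y - γ * jj ν y| ≤ 2 * ν * jj ν y := by
    rw [abs_of_nonpos (by linarith)]
    nlinarith [mul_pos hy hj]
  have hG : 0 < Real.Gamma (ν + 1) := Real.Gamma_pos_of_pos (by linarith)
  have hG2 : 0 < Real.Gamma (ν + 1/2) := Real.Gamma_pos_of_pos (by linarith)
  have hT := Phi_le_total hν' hγ hy.le
  have hP := Phi_nonneg (γ := γ) (ν := ν) hy.le
  have hj2 : jj ν y ≤ Real.exp (γ * y) * ((2:ℝ) ^ (-ν) / Real.Gamma (ν + 1)) := by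
    rw [← jj_zero]
    calc jj ν y = Real.exp (γ * y) * (Real.exp (-(γ * y)) * jj ν y) := by
          rw [← mul_assoc, ← Real.exp_add]; simp
      _ ≤ _ := mul_le_mul_of_nonneg_left hN (Real.exp_pos _).le
  have hgh := gamma_half (ν := ν) (by linarith)
  have hgh2 : ν * (Real.Gamma (ν + 1/2) / Real.Gamma (ν + 1)) ≤ Real.sqrt ν := by
    rw [← mul_div_assoc, div_le_iff₀ hG]; exact hgh
  set Q := 1 / (1 - γ ^ 2) with hQ
  have hQ0 : 0 < Q := by positivity
  have e1 : (1 - γ ^ 2) * Q ^ (ν + 1/2) = Q ^ (ν - 1/2) := by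
    rw [show ν + 1/2 = ν - 1/2 + 1 by ring, Real.rpow_add_one hQ0.ne', hQ]
    field_simp
  have e2 : (2:ℝ) ^ (-ν) * 2 ^ ν = 1 := by
    rw [← Real.rpow_add (by norm_num)]; simp
  calc (1 - γ ^ 2) * (y * |y * jj (ν + 1) y - γ * jj ν y|) * PhiI γ ν y
      ≤ (1 - γ ^ 2) * (2 * ν * (Real.exp (γ * y) * ((2:ℝ) ^ (-ν) / Real.Gamma (ν + 1)))) *
        (2 ^ ν * Real.sqrt π * Q ^ (ν + 1/2) * Real.Gamma (ν + 1/2)) := by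
        apply mul_le_mul _ hT hP (by positivity)
        apply mul_le_mul_of_nonneg_left _ hγ2.le
        exact h1.trans (mul_le_mul_of_nonneg_left hj2 (by linarith))
    _ = 2 * Real.sqrt π * Real.exp (γ * y) * ((1 - γ ^ 2) * Q ^ (ν + 1/2)) * ((2:ℝ) ^ (-ν) * 2 ^ ν) *
        (ν * (Real.Gamma (ν + 1/2) / Real.Gamma (ν + 1))) := by ring
    _ ≤ 2 * Real.sqrt π * Real.exp (γ * y) * ((1 - γ ^ 2) * Q ^ (ν + 1/2)) * ((2:ℝ) ^ (-ν) * 2 ^ ν) * Real.sqrt ν := by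
        gcongr
    _ = _ := by
        rw [e1, e2, Real.sqrt_mul Real.pi_pos.le]; ring

lemma T2_regB {γ ν y : ℝ} (hν : 1/2 ≤ ν) (hγ : |γ| < 1) (hy : 0 < y)
    (hB : γ * jj ν y ≤ y * jj (ν + 1) y) :
    (1 - γ ^ 2) * (y * |y * jj (ν + 1) y - γ * jj ν y|) * PhiI γ ν y ≤ Real.exp (γ * y) := by
  have hν' : -1/2 < ν := by linarith
  have hγ2 : 0 < 1 - γ ^ 2 := by
    have := (sq_lt_one_iff_abs_lt_one γ).2 hγ; linarith
  have hjp : ∀ t, 0 < jj ν t := fun t => jj_pos (by linarith) t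
  have h1 : (y * jj (ν + 1) y / jj ν y - γ) * PhiI γ ν y ≤ Real.exp (γ * y) * kk ν y := by
    apply Phi_le hν' hγ hy
    intro t ht
    have ht0 : 0 < t := hy.trans_le ht
    have hr := ratio_mono hν' (a := y) (b := t) hy.le ht0.le ht
    simp only at hr
    have t1 := jj_turan hν' ht0
    have t2 := kk_turan ν ht0
    rw [kk_rec ν ht0] at t2
    have p1 := jj_pos (ν := ν + 1) (by linarith) t
    have p0 := hjp t
    have k0 := kk_pos ν ht0
    have k1 := kk_pos (ν - 1) ht0
    have key : jj (ν + 1) t * kk ν t ≤ jj ν t * kk (ν - 1) t := by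
      by_contra hcon
      push Not at hcon
      set a := jj (ν + 1) t * kk ν t with ha
      set b := jj ν t * kk (ν - 1) t with hb
      have hb0 : 0 < b := by positivity
      have hJK : 0 < jj ν t * kk ν t := by positivity
      have s1 : t ^ 2 * a ^ 2 + 2 * ν * a * (jj ν t * kk ν t) ≤ (jj ν t * kk ν t) ^ 2 := by
        have : t ^ 2 * jj (ν + 1) t ^ 2 + 2 * ν * jj ν t * jj (ν + 1) t ≤ jj ν t ^ 2 := by
          nlinarith [mul_pos p0 p1]
        have := mul_le_mul_of_nonneg_right this (sq_nonneg (kk ν t))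
        rw [ha]; nlinarith
      have s2 : (jj ν t * kk ν t) ^ 2 ≤ t ^ 2 * b ^ 2 + 2 * ν * b * (jj ν t * kk ν t) := by
        have := mul_le_mul_of_nonneg_right t2 (sq_nonneg (jj ν t))
        rw [hb]; nlinarith
      have s3 : t ^ 2 * b ^ 2 < t ^ 2 * a ^ 2 := by
        have : b ^ 2 < a ^ 2 := by nlinarith
        exact mul_lt_mul_of_pos_left this (by positivity)
      have s4 : 2 * ν * b * (jj ν t * kk ν t) ≤ 2 * ν * a * (jj ν t * kk ν t) := by
        have : 2 * ν * b ≤ 2 * ν * a := by nlinarith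
        exact mul_le_mul_of_nonneg_right this hJK.le
      linarith
    have h3 : y * jj (ν + 1) y / jj ν y * kk ν t ≤ t * kk (ν - 1) t := by
      calc y * jj (ν + 1) y / jj ν y * kk ν t ≤ t * jj (ν + 1) t / jj ν t * kk ν t :=
            mul_le_mul_of_nonneg_right hr k0.le
        _ = t * (jj (ν + 1) t * kk ν t) / jj ν t := by ring
        _ ≤ t * (jj ν t * kk (ν - 1) t) / jj ν t := by gcongr
        _ = _ := by field_simp
    linarith
  have hj := hjp y
  have hw := jk1_le hν' hy
  have hkm := kk_mono (ν := ν) (by linarith) hy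
  have hk := kk_pos ν hy
  rw [abs_of_nonneg (by linarith)]
  calc _ = (1 - γ ^ 2) * (y * jj ν y) * ((y * jj (ν + 1) y / jj ν y - γ) * PhiI γ ν y) := by
        field_simp
    _ ≤ (1 - γ ^ 2) * (y * jj ν y) * (Real.exp (γ * y) * kk ν y) := by gcongr
    _ = (1 - γ ^ 2) * Real.exp (γ * y) * (jj ν y * (y * kk ν y)) := by ring
    _ ≤ (1 - γ ^ 2) * Real.exp (γ * y) * (jj ν y * kk (ν + 1) y) := by gcongr
    _ ≤ (1 - γ ^ 2) * Real.exp (γ * y) * 1 := by gcongr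
    _ ≤ 1 * Real.exp (γ * y) * 1 := by
        have : 1 - γ ^ 2 ≤ 1 := by nlinarith [sq_nonneg γ]
        gcongr
    _ = _ := by ring

/-- The scaled version of the constant. -/
noncomputable def BB (γ ν : ℝ) : ℝ :=
  if 1/2 ≤ ν then Real.sqrt (π * ν) * (1 / (1 - γ ^ 2)) ^ (ν - 1/2) else 2

lemma T_total {γ ν y : ℝ} (hν : -1/2 < ν) (hγ : |γ| < 1) (hy : 0 < y) :
    (1 - γ ^ 2) * (Real.exp (-(γ * y)) * y ^ (-(2 * ν)) * (kk (ν + 1) y + γ * y * kk ν y)) * XX γ ν y +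
    (1 - γ ^ 2) * (Real.exp (-(γ * y)) * (y * |y * jj (ν + 1) y - γ * jj ν y|)) * PhiI γ ν y ≤
      2 + 12 / (2 * ν + 1) + 2 * BB γ ν := by
  have hγ2 : 0 < 1 - γ ^ 2 := by
    have := (sq_lt_one_iff_abs_lt_one γ).2 hγ; linarith
  have hr : 0 < 2 * ν + 1 := by linarith
  have hEE : Real.exp (-(γ * y)) * Real.exp (γ * y) = 1 := by rw [← Real.exp_add]; simp
  have hYY : y ^ (-(2 * ν)) * y ^ (2 * ν) = 1 := by rw [← Real.rpow_add hy]; simp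
  have c1 : ∀ C, (1 - γ ^ 2) * (kk (ν + 1) y + γ * y * kk ν y) * XX γ ν y ≤ C * (Real.exp (γ * y) * y ^ (2 * ν)) →
      (1 - γ ^ 2) * (Real.exp (-(γ * y)) * y ^ (-(2 * ν)) * (kk (ν + 1) y + γ * y * kk ν y)) * XX γ ν y ≤ C := by
    intro C h
    have h2 : 0 ≤ Real.exp (-(γ * y)) * y ^ (-(2 * ν)) := by positivity
    calc _ = (Real.exp (-(γ * y)) * y ^ (-(2 * ν))) *
          ((1 - γ ^ 2) * (kk (ν + 1) y + γ * y * kk ν y) * XX γ ν y) := by ring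
      _ ≤ (Real.exp (-(γ * y)) * y ^ (-(2 * ν))) * (C * (Real.exp (γ * y) * y ^ (2 * ν))) :=
          mul_le_mul_of_nonneg_left h h2
      _ = C * (Real.exp (-(γ * y)) * Real.exp (γ * y)) * (y ^ (-(2 * ν)) * y ^ (2 * ν)) := by ring
      _ = C := by rw [hEE, hYY]; ring
  have c2 : ∀ C, (1 - γ ^ 2) * (y * |y * jj (ν + 1) y - γ * jj ν y|) * PhiI γ ν y ≤ C * Real.exp (γ * y) →
      (1 - γ ^ 2) * (Real.exp (-(γ * y)) * (y * |y * jj (ν + 1) y - γ * jj ν y|)) * PhiI γ ν y ≤ C := by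
    intro C h
    calc _ = Real.exp (-(γ * y)) *
          ((1 - γ ^ 2) * (y * |y * jj (ν + 1) y - γ * jj ν y|) * PhiI γ ν y) := by ring
      _ ≤ Real.exp (-(γ * y)) * (C * Real.exp (γ * y)) :=
          mul_le_mul_of_nonneg_left h (Real.exp_pos _).le
      _ = C * (Real.exp (-(γ * y)) * Real.exp (γ * y)) := by ring
      _ = C := by rw [hEE]; ring
  have hr12 : 0 < 12 / (2 * ν + 1) := by positivity
  unfold BB
  split_ifs with h
  · have a1 := c1 2 (T1_hi h hγ hy)
    rcases le_total (y * jj (ν + 1) y) (γ * jj ν y) with hA | hB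
    · have a2 := c2 _ (T2_regA h hγ hy hA)
      linarith
    · have a2 := c2 1 (by rw [one_mul]; exact T2_regB h hγ hy hB)
      have b1 : 1 ≤ Real.sqrt (π * ν) := by
        rw [Real.one_le_sqrt]
        nlinarith [Real.pi_gt_three]
      have b2 : 1 ≤ (1 / (1 - γ ^ 2)) ^ (ν - 1/2) := by
        apply Real.one_le_rpow _ (by linarith)
        rw [le_div_iff₀ hγ2]
        nlinarith [sq_nonneg γ]
      have : 1 ≤ Real.sqrt (π * ν) * (1 / (1 - γ ^ 2)) ^ (ν - 1/2) := by nlinarith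
      linarith
  · push Not at h
    have a1 := c1 _ (T1_lo hν h.le hγ hy)
    have a2 := c2 2 (T2_lo hν h.le hγ hy)
    have : 8 / (2 * ν + 1) ≤ 12 / (2 * ν + 1) := by gcongr; norm_num
    linarith

lemma deriv_vp {a b u v w H F G : ℝ → ℝ} {y S u' v' : ℝ} (hH : ∀ t, |H t| ≤ S)
    (ha : ContinuousAt a y) (hb : ContinuousAt b y) (hw : ContinuousAt w y)
    (hu : HasDerivAt u u' y) (hv : HasDerivAt v v' y)
    (hia : ∀ᶠ z in nhds y, IntervalIntegrable (fun t => a t * H t) volume y z)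
    (hib : ∀ᶠ z in nhds y, IntervalIntegrable (fun t => b t * H t) volume y z)
    (hF : ∀ᶠ z in nhds y, F z = F y + ∫ t in y..z, a t * H t)
    (hG : ∀ᶠ z in nhds y, G z = G y - ∫ t in y..z, b t * H t)
    (huw : ∀ᶠ z in nhds y, u z = w z * b z) (hvw : ∀ᶠ z in nhds y, v z = w z * a z) :
    HasDerivAt (fun z => u z * F z + v z * G z) (u' * F y + v' * G y) y := by
  have hS : 0 ≤ S := (abs_nonneg _).trans (hH y)
  have hR : HasDerivAt (fun z => w z * ∫ t in y..z, (b z * a t - a z * b t) * H t) 0 y := by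
    rw [hasDerivAt_iff_isLittleO, Asymptotics.isLittleO_iff]
    intro ε hε
    have hW : 0 < |w y| + 1 := by positivity
    have hε' : 0 < ε / ((|w y| + 1) * (S + 1)) := by positivity
    have hcont : ContinuousAt (fun p : ℝ × ℝ => b p.1 * a p.2 - a p.1 * b p.2) (y, y) := by
      have a1 : ContinuousAt (fun p : ℝ × ℝ => a p.1) (y, y) :=
        ContinuousAt.comp (f := Prod.fst) (g := a) (x := (y, y)) ha continuousAt_fst
      have a2 : ContinuousAt (fun p : ℝ × ℝ => a p.2) (y, y) :=
        ContinuousAt.comp (f := Prod.snd) (g := a) (x := (y, y)) ha continuousAt_snd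
      have b1 : ContinuousAt (fun p : ℝ × ℝ => b p.1) (y, y) :=
        ContinuousAt.comp (f := Prod.fst) (g := b) (x := (y, y)) hb continuousAt_fst
      have b2 : ContinuousAt (fun p : ℝ × ℝ => b p.2) (y, y) :=
        ContinuousAt.comp (f := Prod.snd) (g := b) (x := (y, y)) hb continuousAt_snd
      exact (b1.mul a2).sub (a1.mul b2)
    obtain ⟨δ, hδ, hδ2⟩ := Metric.continuousAt_iff.1 hcont _ hε'
    have hwb : ∀ᶠ z in nhds y, |w z| < |w y| + 1 :=
      hw.abs.eventually_lt continuousAt_const (by simp)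
    filter_upwards [hwb, Metric.ball_mem_nhds y hδ] with z hz1 hz2
    rw [Metric.mem_ball, Real.dist_eq] at hz2
    simp only [intervalIntegral.integral_same, mul_zero, sub_zero, smul_zero]
    have hbd : ‖∫ t in y..z, (b z * a t - a z * b t) * H t‖ ≤ (ε / ((|w y| + 1) * (S + 1)) * S) * |z - y| := by
      apply intervalIntegral.norm_integral_le_of_norm_le_const
      intro t ht
      have ht1 : |t - y| ≤ |z - y| := by
        rw [Set.mem_uIoc] at ht
        rcases ht with h | h
        · rw [abs_of_pos (by linarith), abs_of_pos (by linarith)]; linarith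
        · rw [abs_of_nonpos (by linarith), abs_of_neg (by linarith)]; linarith
      have := hδ2 (x := (z, t)) (by
        rw [Prod.dist_eq, Real.dist_eq, Real.dist_eq]
        exact max_lt hz2 (ht1.trans_lt hz2))
      rw [Real.dist_eq] at this
      simp only at this
      rw [show b y * a y - a y * b y = 0 by ring, sub_zero] at this
      rw [norm_mul, Real.norm_eq_abs, Real.norm_eq_abs]
      exact mul_le_mul this.le (hH t) (abs_nonneg _) hε'.le
    rw [norm_mul, Real.norm_eq_abs, Real.norm_eq_abs (z - y)]
    calc |w z| * ‖∫ t in y..z, (b z * a t - a z * b t) * H t‖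
        ≤ (|w y| + 1) * ((ε / ((|w y| + 1) * (S + 1)) * S) * |z - y|) :=
          mul_le_mul hz1.le hbd (norm_nonneg _) hW.le
      _ = ε * (S / (S + 1)) * |z - y| := by field_simp
      _ ≤ ε * 1 * |z - y| := by
          have : S / (S + 1) ≤ 1 := by rw [div_le_one (by positivity)]; linarith
          gcongr
      _ = _ := by ring
  have h0 := ((hu.mul_const (F y)).add (hv.mul_const (G y))).add hR
  rw [add_zero] at h0
  refine h0.congr_of_eventuallyEq ?_
  filter_upwards [hia, hib, hF, hG, huw, hvw] with z h1 h2 h3 h4 h5 h6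
  simp only [Pi.add_apply]
  have e : ∫ t in y..z, (b z * a t - a z * b t) * H t =
      b z * (∫ t in y..z, a t * H t) - a z * ∫ t in y..z, b t * H t := by
    rw [← intervalIntegral.integral_const_mul, ← intervalIntegral.integral_const_mul,
      ← intervalIntegral.integral_sub (h1.const_mul _) (h2.const_mul _)]
    congr 1
    ext t; ring
  rw [e, h3, h4, h5, h6]
  ring

noncomputable def FF (γ ν : ℝ) (H : ℝ → ℝ) (y : ℝ) : ℝ :=
  ∫ t in (0:ℝ)..y, (Real.exp (γ * t) * t ^ (2 * ν) * jj ν t) * H t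

noncomputable def GG (γ ν : ℝ) (H : ℝ → ℝ) (y : ℝ) : ℝ :=
  ∫ t in Set.Ioi y, (Real.exp (γ * t) * kk ν t) * H t

noncomputable def uu (γ ν y : ℝ) : ℝ := Real.exp (-(γ * y)) * y ^ (-(2 * ν)) * kk ν y

noncomputable def vv (γ ν y : ℝ) : ℝ := Real.exp (-(γ * y)) * jj ν y

noncomputable def SS (γ ν : ℝ) (H : ℝ → ℝ) (y : ℝ) : ℝ :=
  -(1 - γ ^ 2) * (uu γ ν y * FF γ ν H y + vv γ ν y * GG γ ν H y)

lemma enegexp (γ t : ℝ) : HasDerivAt (fun t : ℝ => Real.exp (-(γ * t))) (Real.exp (-(γ * t)) * (-γ)) t := by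
  simpa using (((hasDerivAt_id t).const_mul γ).neg).exp

lemma uu_hasDerivAt (γ ν : ℝ) {y : ℝ} (hy : 0 < y) : HasDerivAt (uu γ ν)
    (-(Real.exp (-(γ * y)) * y ^ (-(2 * ν)) * (kk (ν + 1) y + γ * y * kk ν y)) / y) y := by
  have h2 := Real.hasDerivAt_rpow_const (x := y) (p := -(2 * ν)) (Or.inl hy.ne')
  refine (((enegexp γ y).mul h2).mul (kk_hasDerivAt ν hy)).congr_deriv ?_
  simp only [Pi.mul_apply]
  rw [kk_rec ν hy, Real.rpow_sub_one hy.ne']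
  field_simp
  ring

lemma vv_hasDerivAt {γ ν : ℝ} (hν : -1/2 < ν) (y : ℝ) : HasDerivAt (vv γ ν)
    (Real.exp (-(γ * y)) * (y * jj (ν + 1) y - γ * jj ν y)) y := by
  refine ((enegexp γ y).mul (jj_hasDerivAt (ν := ν) (by linarith) y)).congr_deriv ?_
  ring

lemma FF_int {γ ν S : ℝ} {H : ℝ → ℝ} (hν : -1/2 < ν) (hm : Measurable H) (hH : ∀ t, |H t| ≤ S) (a b : ℝ) :
    IntervalIntegrable (fun t => (Real.exp (γ * t) * t ^ (2 * ν) * jj ν t) * H t) volume a b := by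
  have h := X_intervalIntegrable (γ := γ) hν a b
  rw [intervalIntegrable_iff] at h ⊢
  refine Integrable.mul_bdd (c := S) h hm.aestronglyMeasurable ?_
  filter_upwards with t using hH t

lemma GG_int {γ ν S y : ℝ} {H : ℝ → ℝ} (hν : -1/2 < ν) (hγ : |γ| < 1) (hm : Measurable H) (hH : ∀ t, |H t| ≤ S)
    (hy : 0 ≤ y) :
    IntegrableOn (fun t => (Real.exp (γ * t) * kk ν t) * H t) (Set.Ioi y) := by
  refine Integrable.mul_bdd (c := S) (Phi_integrable hν hγ hy) hm.aestronglyMeasurable ?_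
  filter_upwards with t using hH t

lemma FF_le {γ ν S y : ℝ} {H : ℝ → ℝ} (hν : -1/2 < ν) (hH : ∀ t, |H t| ≤ S) (hy : 0 < y) :
    |FF γ ν H y| ≤ XX γ ν y * S := by
  unfold FF XX
  rw [← intervalIntegral.integral_mul_const, ← Real.norm_eq_abs]
  apply intervalIntegral.norm_integral_le_of_norm_le hy.le _ ((X_intervalIntegrable hν 0 y).mul_const S)
  filter_upwards with t ht
  have h0 : 0 < t := ht.1
  have := jj_pos (ν := ν) (by linarith) t
  rw [norm_mul, Real.norm_eq_abs, Real.norm_eq_abs, abs_of_pos (by positivity)]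
  exact mul_le_mul_of_nonneg_left (hH t) (by positivity)

lemma GG_le {γ ν S y : ℝ} {H : ℝ → ℝ} (hν : -1/2 < ν) (hγ : |γ| < 1) (hH : ∀ t, |H t| ≤ S) (hy : 0 < y) :
    |GG γ ν H y| ≤ PhiI γ ν y * S := by
  unfold GG PhiI
  rw [← integral_mul_const, ← Real.norm_eq_abs]
  apply norm_integral_le_of_norm_le ((Phi_integrable hν hγ hy.le).mul_const S)
  filter_upwards [ae_restrict_mem measurableSet_Ioi] with t ht
  have h0 : 0 < t := hy.trans ht
  have := kk_pos ν h0
  rw [norm_mul, Real.norm_eq_abs, Real.norm_eq_abs, abs_of_pos (by positivity)]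
  exact mul_le_mul_of_nonneg_left (hH t) (by positivity)

lemma SS_deriv {γ ν S y : ℝ} {H : ℝ → ℝ} (hν : -1/2 < ν) (hγ : |γ| < 1) (hm : Measurable H)
    (hH : ∀ t, |H t| ≤ S) (hy : 0 < y) :
    ∃ d, HasDerivAt (SS γ ν H) d y ∧ |y * d| ≤ (2 + 12 / (2 * ν + 1) + 2 * BB γ ν) * S := by
  have hS : 0 ≤ S := (abs_nonneg _).trans (hH y)
  have hγ2 : 0 < 1 - γ ^ 2 := by
    have := (sq_lt_one_iff_abs_lt_one γ).2 hγ; linarith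
  have hpos : ∀ᶠ z in nhds y, 0 < z := lt_mem_nhds hy
  have hd := deriv_vp (a := fun t => Real.exp (γ * t) * t ^ (2 * ν) * jj ν t)
    (b := fun t => Real.exp (γ * t) * kk ν t) (u := uu γ ν) (v := vv γ ν)
    (w := fun t => Real.exp (-(γ * t)) * Real.exp (-(γ * t)) * t ^ (-(2 * ν))) (H := H) (F := FF γ ν H) (G := GG γ ν H)
    (y := y) (S := S) hH ?_ ?_ ?_ (uu_hasDerivAt γ ν hy) (vv_hasDerivAt hν y) ?_ ?_ ?_ ?_ ?_ ?_
  · refine ⟨_, hd.const_mul (-(1 - γ ^ 2)), ?_⟩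
    have hT := mul_le_mul_of_nonneg_right (T_total hν hγ hy) hS
    refine le_trans ?_ hT
    have c1 := (coef_le hν hγ hy).1
    have e : y * (-(1 - γ ^ 2) * (-(Real.exp (-(γ * y)) * y ^ (-(2 * ν)) * (kk (ν + 1) y + γ * y * kk ν y)) / y *
          FF γ ν H y + Real.exp (-(γ * y)) * (y * jj (ν + 1) y - γ * jj ν y) * GG γ ν H y)) =
        (1 - γ ^ 2) * (Real.exp (-(γ * y)) * y ^ (-(2 * ν)) * (kk (ν + 1) y + γ * y * kk ν y)) * FF γ ν H y -
        (1 - γ ^ 2) * (Real.exp (-(γ * y)) * (y * (y * jj (ν + 1) y - γ * jj ν y))) * GG γ ν H y := by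
      field_simp
      ring
    rw [e]
    refine (abs_sub _ _).trans ?_
    rw [abs_mul _ (FF γ ν H y), abs_mul _ (GG γ ν H y), add_mul]
    have f1 := FF_le (γ := γ) hν hH hy
    have f2 := GG_le hν hγ hH hy
    have n1 : 0 ≤ (1 - γ ^ 2) * (Real.exp (-(γ * y)) * y ^ (-(2 * ν)) * (kk (ν + 1) y + γ * y * kk ν y)) := by
      positivity
    have n2 : |(1 - γ ^ 2) * (Real.exp (-(γ * y)) * (y * (y * jj (ν + 1) y - γ * jj ν y)))| =
        (1 - γ ^ 2) * (Real.exp (-(γ * y)) * (y * |y * jj (ν + 1) y - γ * jj ν y|)) := by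
      rw [abs_mul, abs_mul, abs_mul, abs_of_pos hγ2, abs_of_pos (Real.exp_pos _), abs_of_pos hy]
    rw [abs_of_nonneg n1, n2, mul_assoc _ (XX γ ν y) S, mul_assoc _ (PhiI γ ν y) S]
    apply add_le_add
    · exact mul_le_mul_of_nonneg_left f1 n1
    · exact mul_le_mul_of_nonneg_left f2 (by positivity)
  · have h2 : ContinuousAt (fun t : ℝ => t ^ (2 * ν)) y := continuousAt_id.rpow_const (Or.inl hy.ne')
    have h1 : Continuous (fun t : ℝ => Real.exp (γ * t)) := by fun_prop
    exact (h1.continuousAt.mul h2).mul (jj_continuous (by linarith)).continuousAt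
  · exact (ek_hasDerivAt γ ν hy).continuousAt
  · have h2 : ContinuousAt (fun t : ℝ => t ^ (-(2 * ν))) y := continuousAt_id.rpow_const (Or.inl hy.ne')
    have h1 : Continuous (fun t : ℝ => Real.exp (-(γ * t)) * Real.exp (-(γ * t))) := by fun_prop
    exact h1.continuousAt.mul h2
  · filter_upwards with z using FF_int hν hm hH y z
  · filter_upwards [hpos] with z hz
    rw [intervalIntegrable_iff]
    refine (GG_int hν hγ hm hH le_rfl).mono_set ?_
    intro t ht
    rw [Set.mem_uIoc] at ht
    rcases ht with h | h
    · exact hy.trans h.1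
    · exact hz.trans h.1
  · filter_upwards with z
    unfold FF
    rw [intervalIntegral.integral_add_adjacent_intervals (FF_int hν hm hH 0 y) (FF_int hν hm hH y z)]
  · filter_upwards [hpos] with z hz
    unfold GG
    have := intervalIntegral.integral_Ioi_sub_Ioi' (GG_int hν hγ hm hH hy.le) (GG_int hν hγ hm hH hz.le)
    linarith
  · filter_upwards [hpos] with z hz
    unfold uu
    have : Real.exp (-(γ * z)) * Real.exp (γ * z) = 1 := by rw [← Real.exp_add]; simp
    calc _ = (Real.exp (-(γ * z)) * Real.exp (γ * z)) * Real.exp (-(γ * z)) * z ^ (-(2 * ν)) * kk ν z := by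
          rw [this]; ring
      _ = _ := by ring
  · filter_upwards [hpos] with z hz
    unfold vv
    have h1 : Real.exp (-(γ * z)) * Real.exp (γ * z) = 1 := by rw [← Real.exp_add]; simp
    have h2 : z ^ (-(2 * ν)) * z ^ (2 * ν) = 1 := by rw [← Real.rpow_add hz]; simp
    calc _ = (Real.exp (-(γ * z)) * Real.exp (γ * z)) * (z ^ (-(2 * ν)) * z ^ (2 * ν)) *
          Real.exp (-(γ * z)) * jj ν z := by
          rw [h1, h2]; ring
      _ = _ := by ring

lemma half_F {α γ β ν : ℝ} (hα : 0 < α) (hβ : β = γ * α) (g : ℝ → ℝ) {x : ℝ} (hx : 0 < x) :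
    ∫ t in (0:ℝ)..x, Real.exp (β * t) * |t| ^ ν * besselI ν (α * |t|) * g t =
      α⁻¹ * (α ^ ν)⁻¹ * FF γ ν (fun s => g (s / α)) (α * x) := by
  have e : ∫ t in (0:ℝ)..x, Real.exp (β * t) * |t| ^ ν * besselI ν (α * |t|) * g t =
      ∫ t in (0:ℝ)..x, (fun s => (α ^ ν)⁻¹ * ((Real.exp (γ * s) * s ^ (2 * ν) * jj ν s) * g (s / α))) (α * t) := by
    rw [intervalIntegral.integral_of_le hx.le, intervalIntegral.integral_of_le hx.le]
    apply setIntegral_congr_fun measurableSet_Ioc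
    intro t ht
    have ht0 : 0 < t := ht.1
    simp only
    rw [abs_of_pos ht0, besselI_eq ν (mul_pos hα ht0), two_mul ν, Real.rpow_add (mul_pos hα ht0),
      Real.mul_rpow hα.le ht0.le, hβ, mul_div_cancel_left₀ t hα.ne',
      show γ * α * t = γ * (α * t) by ring]
    field_simp
  rw [e, intervalIntegral.integral_comp_mul_left (fun s => (α ^ ν)⁻¹ * ((Real.exp (γ * s) * s ^ (2 * ν) * jj ν s) * g (s / α))) hα.ne', mul_zero, intervalIntegral.integral_const_mul, smul_eq_mul]
  unfold FF; ring

lemma half_G {α γ β ν : ℝ} (hα : 0 < α) (hβ : β = γ * α) (g : ℝ → ℝ) {x : ℝ} (hx : 0 < x) :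
    ∫ t in Set.Ioi x, Real.exp (β * t) * |t| ^ ν * besselK ν (α * |t|) * g t =
      α⁻¹ * (α ^ ν)⁻¹ * GG γ ν (fun s => g (s / α)) (α * x) := by
  have e : ∫ t in Set.Ioi x, Real.exp (β * t) * |t| ^ ν * besselK ν (α * |t|) * g t =
      ∫ t in Set.Ioi x, (fun s => (α ^ ν)⁻¹ * ((Real.exp (γ * s) * kk ν s) * g (s / α))) (α * t) := by
    apply setIntegral_congr_fun measurableSet_Ioi
    intro t ht
    have ht0 : 0 < t := hx.trans ht
    simp only
    unfold kk
    rw [abs_of_pos ht0,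
      Real.mul_rpow hα.le ht0.le, hβ, mul_div_cancel_left₀ t hα.ne',
      show γ * α * t = γ * (α * t) by ring]
    field_simp
  rw [e, integral_comp_mul_left_Ioi (fun s => (α ^ ν)⁻¹ * ((Real.exp (γ * s) * kk ν s) * g (s / α))) _ hα, integral_const_mul, smul_eq_mul]
  unfold GG; ring

lemma pref_u {α γ β ν s2 : ℝ} (hα : 0 < α) (hβ : β = γ * α) {x : ℝ} (hx : 0 < x) :
    Real.exp (-β * x) * besselK ν (α * x) / (s2 * x ^ ν) = α ^ ν / s2 * uu γ ν (α * x) := by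
  have hy : 0 < α * x := mul_pos hα hx
  unfold uu kk
  rw [Real.rpow_neg hy.le, two_mul ν, Real.rpow_add hy, Real.mul_rpow hα.le hx.le, hβ,
    show -(γ * α) * x = -(γ * (α * x)) by ring]
  have h1 := Real.rpow_pos_of_pos hα ν
  have h2 := Real.rpow_pos_of_pos hx ν
  field_simp

lemma pref_v {α γ β ν s2 : ℝ} (hα : 0 < α) (hβ : β = γ * α) {x : ℝ} (hx : 0 < x) :
    Real.exp (-β * x) * besselI ν (α * x) / (s2 * x ^ ν) = α ^ ν / s2 * vv γ ν (α * x) := by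
  have hy : 0 < α * x := mul_pos hα hx
  unfold vv
  rw [besselI_eq ν hy, Real.mul_rpow hα.le hx.le, hβ,
    show -(γ * α) * x = -(γ * (α * x)) by ring]
  have h1 := Real.rpow_pos_of_pos hα ν
  have h2 := Real.rpow_pos_of_pos hx ν
  field_simp

/-- Combination of the pieces on a half line. -/
lemma half_comb {α γ β ν s2 : ℝ} (hα : 0 < α) (hβ : β = γ * α) (hs2 : s2⁻¹ = α ^ 2 * (1 - γ ^ 2))
    (g : ℝ → ℝ) {x : ℝ} (hx : 0 < x) :
    -(Real.exp (-β * x) * besselK ν (α * x) / (s2 * x ^ ν)) *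
      (∫ t in (0:ℝ)..x, Real.exp (β * t) * |t| ^ ν * besselI ν (α * |t|) * g t) -
    (Real.exp (-β * x) * besselI ν (α * x) / (s2 * x ^ ν)) *
      (∫ t in Set.Ioi x, Real.exp (β * t) * |t| ^ ν * besselK ν (α * |t|) * g t) =
    α * SS γ ν (fun s => g (s / α)) (α * x) := by
  rw [half_F hα hβ g hx, half_G hα hβ g hx, pref_u hα hβ hx, pref_v hα hβ hx]
  unfold SS
  have h1 := Real.rpow_pos_of_pos hα ν
  rw [div_eq_mul_inv (α ^ ν) s2, hs2]
  field_simp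
  ring

lemma density_eq {r θ σ : ℝ} (hσ : 0 < σ) (t : ℝ) :
    vgDensity r θ σ t = (σ * Real.sqrt π * Real.Gamma (r / 2))⁻¹ *
      ((2 * Real.sqrt (θ ^ 2 + σ ^ 2)) ^ ((r - 1) / 2))⁻¹ *
      (Real.exp (θ / σ ^ 2 * t) * |t| ^ ((r - 1) / 2) *
        besselK ((r - 1) / 2) (Real.sqrt (θ ^ 2 + σ ^ 2) / σ ^ 2 * |t|)) := by
  unfold vgDensity
  rw [Real.div_rpow (abs_nonneg _) (by positivity), show θ * t / σ ^ 2 = θ / σ ^ 2 * t by ring,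
    show Real.sqrt (θ ^ 2 + σ ^ 2) * |t| / σ ^ 2 = Real.sqrt (θ ^ 2 + σ ^ 2) / σ ^ 2 * |t| by ring]
  ring

lemma kernel_int {α γ β ν : ℝ} (hα : 0 < α) (hβ : β = γ * α) (hν : -1/2 < ν) (hγ : |γ| < 1) :
    Integrable (fun t : ℝ => Real.exp (β * t) * |t| ^ ν * besselK ν (α * |t|)) ∧
    ∫ t : ℝ, Real.exp (β * t) * |t| ^ ν * besselK ν (α * |t|) =
      α⁻¹ * (α ^ ν)⁻¹ * (2 ^ ν * Real.sqrt π * (1 / (1 - γ ^ 2)) ^ (ν + 1/2) * Real.Gamma (ν + 1/2)) := by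
  have e : (fun t : ℝ => Real.exp (β * t) * |t| ^ ν * besselK ν (α * |t|)) =
      fun t => (α ^ ν)⁻¹ * (fun s => Real.exp (γ * s) * kk ν |s|) (α * t) := by
    ext t
    simp only
    unfold kk
    rw [abs_mul, abs_of_pos hα, Real.mul_rpow hα.le (abs_nonneg _), hβ, show γ * α * t = γ * (α * t) by ring]
    have h1 := Real.rpow_pos_of_pos hα ν
    field_simp
  obtain ⟨h1, h2⟩ := total_int hν hγ
  rw [e]
  constructor
  · exact (h1.comp_mul_left' hα.ne').const_mul _
  · rw [integral_const_mul, Measure.integral_comp_mul_left (fun s => Real.exp (γ * s) * kk ν |s|), h2, abs_of_pos (inv_pos.2 hα), smul_eq_mul]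
    ring

lemma params {θ σ : ℝ} (hσ : 0 < σ) :
    0 < Real.sqrt (θ ^ 2 + σ ^ 2) ∧ |θ / Real.sqrt (θ ^ 2 + σ ^ 2)| < 1 ∧
    θ / σ ^ 2 = θ / Real.sqrt (θ ^ 2 + σ ^ 2) * (Real.sqrt (θ ^ 2 + σ ^ 2) / σ ^ 2) ∧
    1 / (1 - (θ / Real.sqrt (θ ^ 2 + σ ^ 2)) ^ 2) = 1 + θ ^ 2 / σ ^ 2 ∧
    (σ ^ 2)⁻¹ = (Real.sqrt (θ ^ 2 + σ ^ 2) / σ ^ 2) ^ 2 * (1 - (θ / Real.sqrt (θ ^ 2 + σ ^ 2)) ^ 2) := by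
  have hp : 0 < θ ^ 2 + σ ^ 2 := by positivity
  have hD : 0 < Real.sqrt (θ ^ 2 + σ ^ 2) := Real.sqrt_pos.2 hp
  have hD2 : Real.sqrt (θ ^ 2 + σ ^ 2) ^ 2 = θ ^ 2 + σ ^ 2 := Real.sq_sqrt hp.le
  refine ⟨hD, ?_, ?_, ?_, ?_⟩
  · rw [← sq_lt_one_iff_abs_lt_one, div_pow, hD2, div_lt_one hp]
    nlinarith
  · field_simp
  · rw [div_pow, hD2]
    rw [show 1 - θ ^ 2 / (θ ^ 2 + σ ^ 2) = σ ^ 2 / (θ ^ 2 + σ ^ 2) by field_simp; ring]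
    field_simp
    ring
  · rw [div_pow, div_pow, hD2]
    field_simp
    ring

lemma density_int {r θ σ : ℝ} (hr : 0 < r) (hσ : 0 < σ) :
    Integrable (vgDensity r θ σ) ∧ ∫ t, vgDensity r θ σ t = 1 := by
  obtain ⟨hD, hγ, hβ, hq, -⟩ := params (θ := θ) hσ
  set D := Real.sqrt (θ ^ 2 + σ ^ 2) with hDd
  have hD2 : D ^ 2 = θ ^ 2 + σ ^ 2 := Real.sq_sqrt (by positivity)
  have hα : 0 < D / σ ^ 2 := by positivity
  obtain ⟨h1, h2⟩ := kernel_int (ν := (r - 1) / 2) hα hβ (by linarith) hγ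
  have e := funext (density_eq (r := r) (θ := θ) hσ)
  rw [e]
  constructor
  · exact h1.const_mul _
  · rw [integral_const_mul, h2, hq, show (r - 1) / 2 + 1/2 = r / 2 by ring, ← hDd]
    have hG : 0 < Real.Gamma (r / 2) := Real.Gamma_pos_of_pos (by linarith)
    have hpi : 0 < Real.sqrt π := Real.sqrt_pos.2 Real.pi_pos
    have e1 : 1 + θ ^ 2 / σ ^ 2 = (D / σ) ^ (2:ℝ) := by
      rw [Real.rpow_two, div_pow, hD2]; field_simp; ring
    have e2 : ((1:ℝ) + θ ^ 2 / σ ^ 2) ^ (r / 2) = (D / σ) ^ ((r - 1) / 2) * (D / σ) ^ ((r - 1) / 2) * (D / σ) := by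
      rw [e1, ← Real.rpow_mul (by positivity), ← Real.rpow_add (by positivity),
        ← Real.rpow_add_one (by positivity)]
      congr 1; ring
    rw [e2, Real.mul_rpow (by norm_num) hD.le, Real.div_rpow hD.le hσ.le, Real.div_rpow hD.le (by positivity)]
    have e3 : (σ ^ 2) ^ ((r - 1) / 2) = σ ^ ((r - 1) / 2) * σ ^ ((r - 1) / 2) := by
      rw [sq, Real.mul_rpow hσ.le hσ.le]
    rw [e3]
    have p1 := Real.rpow_pos_of_pos hD ((r - 1) / 2)
    have p2 := Real.rpow_pos_of_pos hσ ((r - 1) / 2)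
    have p3 : (0:ℝ) < 2 ^ ((r - 1) / 2) := by positivity
    field_simp

lemma htilde_meas {r θ σ : ℝ} {h : ℝ → ℝ} (hmeas : Measurable h) : Measurable (htilde r θ σ h) := by
  unfold htilde
  exact hmeas.sub_const _

lemma htilde_kernel_zero {r θ σ : ℝ} (hr : 0 < r) (hσ : 0 < σ) {h : ℝ → ℝ} (hmeas : Measurable h) {M : ℝ}
    (hbd : ∀ t, |h t| ≤ M) :
    Integrable (fun t => Real.exp (θ / σ ^ 2 * t) * |t| ^ ((r - 1) / 2) *
        besselK ((r - 1) / 2) (Real.sqrt (θ ^ 2 + σ ^ 2) / σ ^ 2 * |t|) * htilde r θ σ h t) ∧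
    ∫ t, Real.exp (θ / σ ^ 2 * t) * |t| ^ ((r - 1) / 2) *
        besselK ((r - 1) / 2) (Real.sqrt (θ ^ 2 + σ ^ 2) / σ ^ 2 * |t|) * htilde r θ σ h t = 0 := by
  obtain ⟨d1, d2⟩ := density_int (θ := θ) hr hσ
  have hD := (params (θ := θ) hσ).1
  set c := (σ * Real.sqrt π * Real.Gamma (r / 2))⁻¹ * ((2 * Real.sqrt (θ ^ 2 + σ ^ 2)) ^ ((r - 1) / 2))⁻¹ with hc
  have hc0 : 0 < c := by
    have hG : 0 < Real.Gamma (r / 2) := Real.Gamma_pos_of_pos (by linarith)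
    have hpi : 0 < Real.sqrt π := Real.sqrt_pos.2 Real.pi_pos
    positivity
  have hhp : Integrable (fun t => h t * vgDensity r θ σ t) := by
    refine d1.bdd_mul (c := M) hmeas.aestronglyMeasurable ?_
    filter_upwards with t using hbd t
  have hfun : (fun t => Real.exp (θ / σ ^ 2 * t) * |t| ^ ((r - 1) / 2) *
        besselK ((r - 1) / 2) (Real.sqrt (θ ^ 2 + σ ^ 2) / σ ^ 2 * |t|) * htilde r θ σ h t) =
      fun t => c⁻¹ * (h t * vgDensity r θ σ t - (∫ t, h t * vgDensity r θ σ t) * vgDensity r θ σ t) := by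
    ext t
    have e : vgDensity r θ σ t = c * (Real.exp (θ / σ ^ 2 * t) * |t| ^ ((r - 1) / 2) *
        besselK ((r - 1) / 2) (Real.sqrt (θ ^ 2 + σ ^ 2) / σ ^ 2 * |t|)) := density_eq hσ t
    have e2 : Real.exp (θ / σ ^ 2 * t) * |t| ^ ((r - 1) / 2) *
        besselK ((r - 1) / 2) (Real.sqrt (θ ^ 2 + σ ^ 2) / σ ^ 2 * |t|) = c⁻¹ * vgDensity r θ σ t := by
      rw [e]; field_simp
    rw [e2]
    unfold htilde
    ring
  have hi2 := d1.const_mul (∫ t, h t * vgDensity r θ σ t)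
  rw [hfun]
  constructor
  · exact (hhp.sub hi2).const_mul _
  · rw [integral_const_mul, integral_sub hhp hi2, integral_const_mul, d2]
    ring

lemma stein_pos {r θ σ : ℝ} (hσ : 0 < σ) (h : ℝ → ℝ) {x : ℝ} (hx : 0 < x) :
    steinSolution r θ σ h x = (Real.sqrt (θ ^ 2 + σ ^ 2) / σ ^ 2) *
      SS (θ / Real.sqrt (θ ^ 2 + σ ^ 2)) ((r - 1) / 2)
        (fun s => htilde r θ σ h (s / (Real.sqrt (θ ^ 2 + σ ^ 2) / σ ^ 2)))
        ((Real.sqrt (θ ^ 2 + σ ^ 2) / σ ^ 2) * x) := by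
  obtain ⟨hD, hγ, hβ, hq, hs⟩ := params (θ := θ) hσ
  have hα : 0 < Real.sqrt (θ ^ 2 + σ ^ 2) / σ ^ 2 := by positivity
  unfold steinSolution
  rw [← half_comb hα hβ hs (htilde r θ σ h) hx, abs_of_pos hx]

lemma stein_neg {r θ σ : ℝ} (hr : 0 < r) (hσ : 0 < σ) {h : ℝ → ℝ} (hmeas : Measurable h) {M : ℝ}
    (hbd : ∀ t, |h t| ≤ M) {x : ℝ} (hx : 0 < x) :
    steinSolution r θ σ h (-x) = -((Real.sqrt (θ ^ 2 + σ ^ 2) / σ ^ 2) *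
      SS (-(θ / Real.sqrt (θ ^ 2 + σ ^ 2))) ((r - 1) / 2)
        (fun s => htilde r θ σ h (-(s / (Real.sqrt (θ ^ 2 + σ ^ 2) / σ ^ 2))))
        ((Real.sqrt (θ ^ 2 + σ ^ 2) / σ ^ 2) * x)) := by
  obtain ⟨hD, hγ, hβ, hq, hs⟩ := params (θ := θ) hσ
  have hα : 0 < Real.sqrt (θ ^ 2 + σ ^ 2) / σ ^ 2 := by positivity
  obtain ⟨k1, k2⟩ := htilde_kernel_zero (θ := θ) hr hσ hmeas hbd
  have hβ' : -(θ / σ ^ 2) = -(θ / Real.sqrt (θ ^ 2 + σ ^ 2)) * (Real.sqrt (θ ^ 2 + σ ^ 2) / σ ^ 2) := by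
    rw [hβ]; ring
  rw [← neg_sq (θ / Real.sqrt (θ ^ 2 + σ ^ 2))] at hs
  rw [← half_comb hα hβ' hs (fun t => htilde r θ σ h (-t)) hx]
  unfold steinSolution
  rw [abs_neg, abs_of_pos hx]
  have i1 : (∫ t in (0:ℝ)..(-x), Real.exp ((θ / σ ^ 2) * t) * |t| ^ ((r - 1) / 2) *
      besselI ((r - 1) / 2) (Real.sqrt (θ ^ 2 + σ ^ 2) / σ ^ 2 * |t|) * htilde r θ σ h t) =
      -∫ t in (0:ℝ)..x, Real.exp (-(θ / σ ^ 2) * t) * |t| ^ ((r - 1) / 2) *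
      besselI ((r - 1) / 2) (Real.sqrt (θ ^ 2 + σ ^ 2) / σ ^ 2 * |t|) * htilde r θ σ h (-t) := by
    have := intervalIntegral.integral_comp_neg (a := 0) (b := x)
      (fun t => Real.exp ((θ / σ ^ 2) * t) * |t| ^ ((r - 1) / 2) *
      besselI ((r - 1) / 2) (Real.sqrt (θ ^ 2 + σ ^ 2) / σ ^ 2 * |t|) * htilde r θ σ h t)
    simp only [abs_neg, mul_neg, neg_zero] at this
    simp only [neg_mul]
    rw [this, intervalIntegral.integral_symm]
  have i2 : (∫ t in Set.Ioi (-x), Real.exp ((θ / σ ^ 2) * t) * |t| ^ ((r - 1) / 2) *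
      besselK ((r - 1) / 2) (Real.sqrt (θ ^ 2 + σ ^ 2) / σ ^ 2 * |t|) * htilde r θ σ h t) =
      -∫ t in Set.Ioi x, Real.exp (-(θ / σ ^ 2) * t) * |t| ^ ((r - 1) / 2) *
      besselK ((r - 1) / 2) (Real.sqrt (θ ^ 2 + σ ^ 2) / σ ^ 2 * |t|) * htilde r θ σ h (-t) := by
    have := integral_comp_neg_Ioi x
      (fun t => Real.exp ((θ / σ ^ 2) * t) * |t| ^ ((r - 1) / 2) *
      besselK ((r - 1) / 2) (Real.sqrt (θ ^ 2 + σ ^ 2) / σ ^ 2 * |t|) * htilde r θ σ h t)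
    simp only [abs_neg, mul_neg] at this
    simp only [neg_mul]
    rw [this]
    have h3 := intervalIntegral.integral_Iic_add_Ioi (b := -x) k1.integrableOn k1.integrableOn
    rw [k2] at h3
    linarith
  rw [i1, i2]
  simp only [neg_mul, mul_neg, neg_neg]
  ring

lemma BB_eq {r θ σ : ℝ} (hσ : 0 < σ) :
    BB (θ / Real.sqrt (θ ^ 2 + σ ^ 2)) ((r - 1) / 2) = Bconst r θ σ := by
  have hq := (params (θ := θ) hσ).2.2.2.1
  unfold BB Bconst
  rw [hq]
  have : (1 / 2 ≤ (r - 1) / 2) ↔ 2 ≤ r := by constructor <;> intro h <;> linarith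
  simp only [this]
  rw [show π * ((r - 1) / 2) = π * (r - 1) / 2 by ring, show (r - 1) / 2 - 1 / 2 = r / 2 - 1 by ring]

theorem stein_factor_xf'_bounded (r θ σ : ℝ) (hr : 0 < r) (hσ : 0 < σ)
    (h : ℝ → ℝ) (hmeas : Measurable h) (M : ℝ) (hbd : ∀ t, |h t| ≤ M) :
    ∀ x : ℝ, x ≠ 0 → ∀ d : ℝ, HasDerivAt (steinSolution r θ σ h) d x →
      |x * d| ≤
        (2 * Real.sqrt (θ ^ 2 + σ ^ 2) / σ ^ 2) * (1 + 6 / r + Bconst r θ σ) *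
          ⨆ t : ℝ, |htilde r θ σ h t| := by
  intro x hx d hd
  obtain ⟨hD, hγ, hβ, hq, hs⟩ := params (θ := θ) hσ
  have hα : 0 < Real.sqrt (θ ^ 2 + σ ^ 2) / σ ^ 2 := by positivity
  have hν : -1/2 < (r - 1) / 2 := by linarith
  have hBdd : BddAbove (Set.range fun t : ℝ => |htilde r θ σ h t|) := by
    refine ⟨M + |∫ t, h t * vgDensity r θ σ t|, ?_⟩
    rintro _ ⟨t, rfl⟩
    simp only
    unfold htilde
    exact (abs_sub _ _).trans (add_le_add (hbd t) le_rfl)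
  have hS : ∀ t, |htilde r θ σ h t| ≤ ⨆ t : ℝ, |htilde r θ σ h t| := fun t => le_ciSup hBdd t
  have hm := htilde_meas (r := r) (θ := θ) (σ := σ) hmeas
  have hBE := BB_eq (r := r) (θ := θ) hσ
  have hBn : BB (-(θ / Real.sqrt (θ ^ 2 + σ ^ 2))) ((r - 1) / 2) = Bconst r θ σ := by
    rw [← hBE]; unfold BB; rw [neg_sq]
  have hP := @stein_pos r θ σ hσ h
  have hN := @stein_neg r θ σ hr hσ h hmeas M hbd
  set S := ⨆ t : ℝ, |htilde r θ σ h t|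
  have hfin : (2 * Real.sqrt (θ ^ 2 + σ ^ 2) / σ ^ 2) * (1 + 6 / r + Bconst r θ σ) * S =
      (Real.sqrt (θ ^ 2 + σ ^ 2) / σ ^ 2) * ((2 + 12 / (2 * ((r - 1) / 2) + 1) + 2 * Bconst r θ σ) * S) := by
    rw [show 2 * ((r - 1) / 2) + 1 = r by ring]; ring
  rw [hfin]
  set α := Real.sqrt (θ ^ 2 + σ ^ 2) / σ ^ 2
  set γ := θ / Real.sqrt (θ ^ 2 + σ ^ 2)
  rcases lt_or_gt_of_ne hx with hneg | hpos
  · have hy : 0 < α * (-x) := mul_pos hα (by linarith)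
    obtain ⟨d0, h1, h2⟩ := SS_deriv (γ := -γ) (H := fun s => htilde r θ σ h (-(s / α))) (S := S) hν (by rwa [abs_neg])
      (hm.comp (by fun_prop)) (fun t => hS _) hy
    have hl : HasDerivAt (fun x : ℝ => α * (-x)) (-α) x := by
      simpa using ((hasDerivAt_id x).neg.const_mul α)
    have hc := ((HasDerivAt.comp x h1 hl).const_mul α).neg
    have he : steinSolution r θ σ h =ᶠ[nhds x] fun z => -(α * SS (-γ) ((r - 1) / 2)
        (fun s => htilde r θ σ h (-(s / α))) (α * (-z))) := by
      filter_upwards [gt_mem_nhds hneg] with z hz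
      rw [← hN (x := -z) (by linarith), neg_neg]
    have := hd.unique (hc.congr_of_eventuallyEq he)
    rw [this, show x * (-(α * (d0 * -α))) = -(α * (α * (-x) * d0)) by ring, abs_neg, abs_mul, abs_of_pos hα]
    rw [hBn] at h2
    exact mul_le_mul_of_nonneg_left h2 hα.le
  · have hy : 0 < α * x := mul_pos hα hpos
    obtain ⟨d0, h1, h2⟩ := SS_deriv (γ := γ) (H := fun s => htilde r θ σ h (s / α)) (S := S) hν hγ
      (hm.comp (by fun_prop)) (fun t => hS _) hy
    have hl : HasDerivAt (fun x : ℝ => α * x) α x := by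
      simpa using ((hasDerivAt_id x).const_mul α)
    have hc := (HasDerivAt.comp x h1 hl).const_mul α
    have he : steinSolution r θ σ h =ᶠ[nhds x] fun z => α * SS γ ((r - 1) / 2)
        (fun s => htilde r θ σ h (s / α)) (α * z) := by
      filter_upwards [lt_mem_nhds hpos] with z hz
      exact hP hz
    have := hd.unique (hc.congr_of_eventuallyEq he)
    rw [this, show x * (α * (d0 * α)) = α * (α * x * d0) by ring, abs_mul, abs_of_pos hα]
    rw [hBE] at h2
    exact mul_le_mul_of_nonneg_left h2 hα.le
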